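/- For all reals p, q with 2 ≤ q < p < ∞, the Euclidean-embedding exponents satisfy ξ_p ≤ max{1/2, ξ_q} + p/q − 1. -/

import Mathlib

noncomputable section

open scoped NNReal ENNReal

/-- A metric space `M` embeds into `N` with distortion at most `D`: there are `s > 0` and
`f : M → N` with `(s / D) * dist x y ≤ dist (f x) (f y) ≤ s * dist x y` for all `x, y`. -/
def EmbedsWithDistortion (M N : Type*) [PseudoMetricSpace M] [PseudoMetricSpace N]
    (D : ℝ) : Prop :=
  ∃ s : ℝ, 0 < s ∧ ∃ f : M → N, ∀ x y : M,
    s / D * dist x y ≤ dist (f x) (f y) ∧ dist (f x) (f y) ≤ s * dist x y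

/-- `c₂(X)`: the least distortion (at least `1`) with which `X` embeds into `ℓ_2`. -/
noncomputable def c2 (X : Type*) [PseudoMetricSpace X] : ℝ :=
  sInf {D : ℝ | 1 ≤ D ∧ EmbedsWithDistortion X (lp (fun _ : ℕ => ℝ) 2) D}

/-- `c₂ⁿ(M) = sup { c₂(C) : C ⊆ M, |C| ≤ n }`. -/
noncomputable def c2n (M : Type*) [PseudoMetricSpace M] (n : ℕ) : ℝ :=
  sSup {r : ℝ | ∃ C : Set M, C.Finite ∧ C.ncard ≤ n ∧ r = c2 ↥C}

/-- `ξ_r = inf { θ ≥ 0 : ∃ ν > 0, ∀ n ≥ 2, c₂ⁿ(ℓ_r) ≤ ν * (log n)^θ }`. -/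
noncomputable def xi (r : ℝ) [Fact (1 ≤ ENNReal.ofReal r)] : ℝ :=
  sInf {θ : ℝ | 0 ≤ θ ∧ ∃ ν : ℝ, 0 < ν ∧ ∀ n : ℕ, 2 ≤ n →
    c2n (lp (fun _ : ℕ => ℝ) (ENNReal.ofReal r)) n ≤ ν * Real.log n ^ θ}

/-- The real Hilbert space of square-summable sequences. -/
abbrev SeqL2 : Type := lp (fun _ : ℕ => ℝ) 2

lemma orthonormal_single : Orthonormal ℝ (fun i : ℕ => (lp.single 2 i (1 : ℝ) : SeqL2)) := by
  rw [orthonormal_iff_ite]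
  intro i j
  rw [lp.inner_single_left]
  by_cases h : i = j
  · subst h; simp
  · simp [lp.single_apply, h]

lemma exists_seqL2_inner_eq {X V : Type*} [Finite X] [NormedAddCommGroup V]
    [InnerProductSpace ℝ V] (f : X → V) :
    ∃ g : X → SeqL2, ∀ x y, inner ℝ (g x) (g y) = inner ℝ (f x) (f y) := by
  let W : Submodule ℝ V := Submodule.span ℝ (Set.range f)
  have : FiniteDimensional ℝ W := FiniteDimensional.span_of_finite ℝ (Set.finite_range f)
  let b := stdOrthonormalBasis ℝ W
  let f' : X → W := fun x => ⟨f x, Submodule.subset_span ⟨x, rfl⟩⟩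
  have ho : Orthonormal ℝ
      (fun i : Fin (Module.finrank ℝ W) => (lp.single 2 (i : ℕ) (1 : ℝ) : SeqL2)) :=
    orthonormal_single.comp _ Fin.val_injective
  refine ⟨fun x => ∑ i, (inner ℝ (b i) (f' x)) •
    (lp.single 2 (i : ℕ) (1 : ℝ) : SeqL2), fun x y => ?_⟩
  rw [ho.inner_sum]
  have h := b.sum_inner_mul_inner (f' x) (f' y)
  have h2 : inner ℝ (f x) (f y) = inner ℝ (f' x) (f' y) := rfl
  rw [h2, ← h]
  refine Finset.sum_congr rfl fun i _ => ?_
  simp [real_inner_comm]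

lemma norm_sub_eq_of_inner_eq {X V W : Type*} [NormedAddCommGroup V] [InnerProductSpace ℝ V]
    [NormedAddCommGroup W] [InnerProductSpace ℝ W] {f : X → V} {g : X → W}
    (h : ∀ x y, inner ℝ (g x) (g y) = inner ℝ (f x) (f y)) (x y : X) :
    ‖g x - g y‖ = ‖f x - f y‖ := by
  have : ‖g x - g y‖ ^ 2 = ‖f x - f y‖ ^ 2 := by
    rw [norm_sub_sq_real, norm_sub_sq_real, ← real_inner_self_eq_norm_sq,
      ← real_inner_self_eq_norm_sq, ← real_inner_self_eq_norm_sq, ← real_inner_self_eq_norm_sq,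
      h, h, h]
  exact (sq_eq_sq₀ (norm_nonneg _) (norm_nonneg _)).1 this

/-- Finite families of Hilbert-space valued maps have a direct sum. -/
lemma exists_direct_sum {X ι : Type*} [Finite X] [Fintype ι] (f : ι → X → SeqL2) :
    ∃ g : X → SeqL2, (∀ x y, inner ℝ (g x) (g y) = ∑ i, inner ℝ (f i x) (f i y)) ∧
      ∀ x y, ‖g x - g y‖ ^ 2 = ∑ i, ‖f i x - f i y‖ ^ 2 := by
  let F : X → PiLp 2 (fun _ : ι => SeqL2) := fun x => WithLp.toLp 2 (fun i => f i x)
  obtain ⟨g, hg⟩ := exists_seqL2_inner_eq F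
  refine ⟨g, fun x y => ?_, fun x y => ?_⟩
  · rw [hg, PiLp.inner_apply]
  · rw [norm_sub_eq_of_inner_eq hg, PiLp.norm_sq_eq_of_L2]
    rfl

lemma abs_one_sub_prod_le {ι : Type*} (s : Finset ι) (c : ι → ℝ) (hc : ∀ i, |c i| ≤ 1) :
    1 - ∏ i ∈ s, c i ≤ ∑ i ∈ s, (1 - c i) := by
  classical
  induction s using Finset.induction_on with
  | empty => simp
  | insert a s ha ih =>
    rw [Finset.prod_insert ha, Finset.sum_insert ha]
    have h1 := abs_le.1 (hc a)
    have h2 : |∏ i ∈ s, c i| ≤ 1 := by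
      rw [Finset.abs_prod]
      exact Finset.prod_le_one (fun _ _ => abs_nonneg _) fun i _ => hc i
    have h3 := abs_le.1 h2
    nlinarith [mul_nonneg (sub_nonneg.2 h1.2) (sub_nonneg.2 h3.2)]

/-- The gap in inner product guaranteed by `exists_sphere_map`. -/
def sphereGap : ℝ := 1 - Real.exp (-(2 / Real.pi ^ 2))

lemma sphereGap_pos : 0 < sphereGap := by
  have : Real.exp (-(2 / Real.pi ^ 2)) < 1 := by
    rw [Real.exp_lt_one_iff]
    have := Real.pi_pos
    have : 0 < 2 / Real.pi ^ 2 := by positivity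
    linarith
  unfold sphereGap; linarith

lemma sphereGap_le_one : sphereGap ≤ 1 := by
  have := Real.exp_pos (-(2 / Real.pi ^ 2))
  unfold sphereGap; linarith

/-- The tensor product of the planar rotations by the angles `u i`. -/
def trigTensor {ι : Type*} [Fintype ι] (u : ι → ℝ) : EuclideanSpace ℝ (ι → Bool) :=
  WithLp.toLp 2 fun s => ∏ i, if s i then Real.cos (u i) else Real.sin (u i)

lemma inner_trigTensor {ι : Type*} [Fintype ι] [DecidableEq ι] (u v : ι → ℝ) :
    inner ℝ (trigTensor u) (trigTensor v) = ∏ i, Real.cos (u i - v i) := by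
  have h : ∀ i, Real.cos (u i - v i) = ∑ b : Bool, (if b then Real.cos (v i) else Real.sin (v i)) *
      (if b then Real.cos (u i) else Real.sin (u i)) := by
    intro i
    rw [Real.cos_sub]
    simp
    ring
  simp_rw [h]
  rw [Finset.prod_univ_sum, PiLp.inner_apply, Fintype.piFinset_univ]
  refine Finset.sum_congr rfl fun s _ => ?_
  rw [Finset.prod_mul_distrib]
  simp [trigTensor]

/-- A finite subset of Hilbert space maps to the unit sphere so that the distances are comparable
with the minimum of `1` and the original distances. -/
lemma exists_sphere_map {X : Type*} [Finite X] (F : X → SeqL2) :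
    ∃ G : X → SeqL2, (∀ x, ‖G x‖ = 1) ∧ (∀ x y, ‖G x - G y‖ ≤ ‖F x - F y‖) ∧
      ∀ x y, 1 ≤ ‖F x - F y‖ → inner ℝ (G x) (G y) ≤ 1 - sphereGap := by
  classical
  let W : Submodule ℝ SeqL2 := Submodule.span ℝ (Set.range F)
  have : FiniteDimensional ℝ W := FiniteDimensional.span_of_finite ℝ (Set.finite_range F)
  let b := stdOrthonormalBasis ℝ W
  let F' : X → W := fun x => ⟨F x, Submodule.subset_span ⟨x, rfl⟩⟩
  let u : X → Fin (Module.finrank ℝ W) → ℝ := fun x i => b.repr (F' x) i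
  have hu : ∀ x y, ∑ i, (u x i - u y i) ^ 2 = ‖F x - F y‖ ^ 2 := by
    intro x y
    have h1 : ‖F x - F y‖ = ‖F' x - F' y‖ := rfl
    rw [h1, ← b.repr.norm_map, map_sub, EuclideanSpace.norm_sq_eq]
    simp [u]
  have := Fintype.ofFinite X
  obtain ⟨M, hM⟩ := exists_nat_ge (1 + ∑ x, ∑ y, ‖F x - F y‖)
  have hsum : ∀ x y, ‖F x - F y‖ ≤ ∑ x, ∑ y, ‖F x - F y‖ := fun x y =>
    (Finset.single_le_sum (f := fun y => ‖F x - F y‖) (fun _ _ => norm_nonneg _)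
      (Finset.mem_univ y)).trans
      (Finset.single_le_sum (f := fun x => ∑ y, ‖F x - F y‖)
        (fun _ _ => Finset.sum_nonneg fun _ _ => norm_nonneg _) (Finset.mem_univ x))
  have hM1 : ∀ x y, ‖F x - F y‖ ≤ M := fun x y => by linarith [hsum x y]
  have hsum0 : 0 ≤ ∑ x, ∑ y, ‖F x - F y‖ :=
    Finset.sum_nonneg fun _ _ => Finset.sum_nonneg fun _ _ => norm_nonneg _
  have hM0 : (1 : ℝ) ≤ M :=
    le_trans (by linarith [hsum0]) hM
  have hMpos : (0 : ℝ) < M := by linarith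
  let w : X → Fin (Module.finrank ℝ W) × Fin (M ^ 2) → ℝ := fun x i => u x i.1 / M
  obtain ⟨G, hG⟩ := exists_seqL2_inner_eq fun x => trigTensor (w x)
  have hG' : ∀ x y, inner ℝ (G x) (G y) = ∏ i, Real.cos (w x i - w y i) := fun x y => by
    rw [hG, inner_trigTensor]
  have hnorm : ∀ x, ‖G x‖ = 1 := by
    intro x
    have h : ‖G x‖ ^ 2 = 1 := by rw [← real_inner_self_eq_norm_sq, hG']; simp
    nlinarith [norm_nonneg (G x)]
  have hsq : ∀ x y, ∑ i, (w x i - w y i) ^ 2 = ‖F x - F y‖ ^ 2 := by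
    intro x y
    rw [← hu, Fintype.sum_prod_type]
    refine Finset.sum_congr rfl fun i _ => ?_
    simp only [w, Finset.sum_const, Finset.card_univ, Fintype.card_fin, nsmul_eq_mul]
    push_cast
    field_simp
  have habs : ∀ x y i, |w x i - w y i| ≤ 1 := by
    intro x y i
    have h1 : |u x i.1 - u y i.1| ≤ M := by
      refine le_trans ?_ (hM1 x y)
      refine abs_le_of_sq_le_sq ?_ (norm_nonneg _)
      rw [← hu]
      exact Finset.single_le_sum (f := fun i => (u x i - u y i) ^ 2)
        (fun _ _ => sq_nonneg _) (Finset.mem_univ i.1)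
    have h2 : w x i - w y i = (u x i.1 - u y i.1) / M := by simp only [w]; ring
    rw [h2, abs_div, abs_of_pos hMpos, div_le_one hMpos]
    exact h1
  refine ⟨G, hnorm, fun x y => ?_, fun x y hxy => ?_⟩
  · refine le_of_sq_le_sq ?_ (norm_nonneg _)
    rw [norm_sub_sq_real, hnorm, hnorm, hG', ← hsq]
    have h1 := abs_one_sub_prod_le Finset.univ (fun i => Real.cos (w x i - w y i))
      fun i => Real.abs_cos_le_one _
    have h2 : ∑ i, (1 - Real.cos (w x i - w y i)) ≤ ∑ i, (w x i - w y i) ^ 2 / 2 :=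
      Finset.sum_le_sum fun i _ => by
        linarith [Real.one_sub_sq_div_two_le_cos (x := w x i - w y i)]
    rw [← Finset.sum_div] at h2
    linarith
  · rw [hG']
    have hpi := Real.pi_gt_three
    have h1 : ∏ i, Real.cos (w x i - w y i) ≤
        ∏ i, Real.exp (-(2 / Real.pi ^ 2) * (w x i - w y i) ^ 2) := by
      refine Finset.prod_le_prod (fun i _ => ?_) fun i _ => ?_
      · have := abs_le.1 (habs x y i)
        exact Real.cos_nonneg_of_mem_Icc ⟨by linarith, by linarith⟩
      · have := Real.cos_le_one_sub_mul_cos_sq (x := w x i - w y i)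
          (by linarith [habs x y i])
        have h3 := Real.add_one_le_exp (-(2 / Real.pi ^ 2) * (w x i - w y i) ^ 2)
        linarith
    rw [← Real.exp_sum, ← Finset.mul_sum, hsq] at h1
    refine h1.trans ?_
    unfold sphereGap
    rw [sub_sub_cancel]
    refine Real.exp_le_exp.2 ?_
    have : 0 < 2 / Real.pi ^ 2 := by positivity
    nlinarith [mul_le_mul hxy hxy zero_le_one (norm_nonneg _)]

/-- A semiconvexity condition on functions on `E × H`, in terms of second differences. -/
def SecondDiffBound {E H : Type*} [NormedAddCommGroup E] [NormedAddCommGroup H] (S : ℝ)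
    (v : E → H → ℝ) : Prop :=
  ∀ x y h k, 2 * v x y - 2 * S * (‖h‖ ^ 2 + ‖k‖ ^ 2) ≤ v (x + h) (y + k) + v (x - h) (y - k)

/-- A function on a Hilbert space with second differences of quadratic size has a gradient. -/
lemma exists_gradient {H : Type*} [NormedAddCommGroup H] [InnerProductSpace ℝ H] [CompleteSpace H]
    (u : H → ℝ) (S B : ℝ) (hS : 0 ≤ S)
    (hu : ∀ y k, |u (y + k) + u (y - k) - 2 * u y| ≤ 2 * S * ‖k‖ ^ 2)
    (hB : ∀ y, ‖y‖ ≤ 1 → |u y - u 0| ≤ B) :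
    ∃ g : H, ∀ y, |u y - u 0 - inner ℝ g y| ≤ S * ‖y‖ ^ 2 := by
  set e : H → ℝ := fun y => u y - u 0 with he
  have e0 : e 0 = 0 := by simp [he]
  have hadd : ∀ y z, |e (y + z) - e y - e z| ≤ S * (‖y‖ ^ 2 + ‖z‖ ^ 2) := by
    intro y z
    have h1 := hu ((1 / 2 : ℝ) • (y + z)) ((1 / 2 : ℝ) • (y + z))
    have h2 := hu ((1 / 2 : ℝ) • (y + z)) ((1 / 2 : ℝ) • (y - z))
    have a1 : (1 / 2 : ℝ) • (y + z) + (1 / 2 : ℝ) • (y + z) = y + z := by module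
    have a2 : (1 / 2 : ℝ) • (y + z) + (1 / 2 : ℝ) • (y - z) = y := by module
    have a3 : (1 / 2 : ℝ) • (y + z) - (1 / 2 : ℝ) • (y - z) = z := by module
    rw [a1, sub_self] at h1
    rw [a2, a3] at h2
    rw [norm_smul] at h1 h2
    have hp := parallelogram_law_with_norm ℝ y z
    rw [abs_le] at h1 h2 ⊢
    norm_num at h1 h2
    simp only [he]
    constructor <;> nlinarith
  set a : H → ℕ → ℝ := fun y m => 2 ^ m * e ((1 / 2 : ℝ) ^ m • y) with ha
  have hstep : ∀ y m, dist (a y m) (a y (m + 1)) ≤ (S * ‖y‖ ^ 2 / 2) * (1 / 2) ^ m := by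
    intro y m
    have h := hadd ((1 / 2 : ℝ) ^ (m + 1) • y) ((1 / 2 : ℝ) ^ (m + 1) • y)
    have h1 : (1 / 2 : ℝ) ^ (m + 1) • y + (1 / 2 : ℝ) ^ (m + 1) • y = (1 / 2 : ℝ) ^ m • y := by
      rw [← add_smul, pow_succ]; congr 1; ring
    rw [h1, norm_smul, norm_pow, Real.norm_of_nonneg (by norm_num : (0 : ℝ) ≤ 1 / 2)] at h
    have h2 : a y m - a y (m + 1) = 2 ^ m * (e ((1 / 2 : ℝ) ^ m • y) -
        e ((1 / 2 : ℝ) ^ (m + 1) • y) - e ((1 / 2 : ℝ) ^ (m + 1) • y)) := by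
      simp only [ha]; ring
    rw [Real.dist_eq, h2, abs_mul, abs_of_pos (by positivity : (0 : ℝ) < 2 ^ m)]
    refine (mul_le_mul_of_nonneg_left h (by positivity)).trans (le_of_eq ?_)
    have h3 : (2 : ℝ) ^ m * (1 / 2) ^ m = 1 := by rw [← mul_pow]; norm_num
    calc 2 ^ m * (S * (((1 / 2) ^ (m + 1) * ‖y‖) ^ 2 + ((1 / 2) ^ (m + 1) * ‖y‖) ^ 2))
        = (2 ^ m * (1 / 2) ^ m) * (S * ‖y‖ ^ 2 / 2 * (1 / 2) ^ m) := by ring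
      _ = _ := by rw [h3, one_mul]
  have hconv : ∀ y, ∃ l, Filter.Tendsto (a y) Filter.atTop (nhds l) := fun y =>
    cauchySeq_tendsto_of_complete (cauchySeq_of_le_geometric _ _ (by norm_num) (hstep y))
  choose D hD using hconv
  have hDe : ∀ y, |D y - e y| ≤ S * ‖y‖ ^ 2 := by
    intro y
    have h := dist_le_of_le_geometric_of_tendsto₀ (1 / 2) _ (by norm_num) (hstep y) (hD y)
    rw [dist_comm, Real.dist_eq] at h
    have h0 : a y 0 = e y := by simp [ha]
    rw [h0] at h
    refine h.trans (le_of_eq ?_)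
    ring
  have hDadd : ∀ y z, D (y + z) = D y + D z := by
    intro y z
    have h1 : Filter.Tendsto (fun m => a (y + z) m - a y m - a z m) Filter.atTop
        (nhds (D (y + z) - D y - D z)) := ((hD _).sub (hD _)).sub (hD _)
    have h2 : Filter.Tendsto (fun m => a (y + z) m - a y m - a z m) Filter.atTop (nhds 0) := by
      refine squeeze_zero_norm (a := fun m => (S * (‖y‖ ^ 2 + ‖z‖ ^ 2)) * (1 / 2) ^ m)
        (fun m => ?_) ?_
      · have h := hadd ((1 / 2 : ℝ) ^ m • y) ((1 / 2 : ℝ) ^ m • z)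
        rw [← smul_add, norm_smul, norm_smul, norm_pow,
          Real.norm_of_nonneg (by norm_num : (0 : ℝ) ≤ 1 / 2)] at h
        have h3 : a (y + z) m - a y m - a z m = 2 ^ m * (e ((1 / 2 : ℝ) ^ m • (y + z)) -
          e ((1 / 2 : ℝ) ^ m • y) - e ((1 / 2 : ℝ) ^ m • z)) := by simp only [ha]; ring
        rw [Real.norm_eq_abs, h3, abs_mul, abs_of_pos (by positivity : (0 : ℝ) < 2 ^ m)]
        refine (mul_le_mul_of_nonneg_left h (by positivity)).trans (le_of_eq ?_)
        have h3 : (2 : ℝ) ^ m * (1 / 2) ^ m = 1 := by rw [← mul_pow]; norm_num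
        calc 2 ^ m * (S * (((1 / 2) ^ m * ‖y‖) ^ 2 + ((1 / 2) ^ m * ‖z‖) ^ 2))
            = (2 ^ m * (1 / 2) ^ m) * (S * (‖y‖ ^ 2 + ‖z‖ ^ 2) * (1 / 2) ^ m) := by ring
          _ = _ := by rw [h3, one_mul]
      · simpa using (tendsto_pow_atTop_nhds_zero_of_lt_one (r := (1 / 2 : ℝ)) (by norm_num)
          (by norm_num)).const_mul (S * (‖y‖ ^ 2 + ‖z‖ ^ 2))
    have := tendsto_nhds_unique h1 h2
    linarith
  let Dh : H →+ ℝ := AddMonoidHom.mk' D hDadd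
  have hcont : Continuous Dh := by
    refine Dh.continuous_of_isBounded_nhds_zero (Metric.ball_mem_nhds 0 one_pos) ?_
    refine (Metric.isBounded_closedBall (x := (0 : ℝ)) (r := B + S)).subset ?_
    rintro _ ⟨y, hy, rfl⟩
    rw [mem_ball_zero_iff] at hy
    rw [mem_closedBall_zero_iff, Real.norm_eq_abs]
    have h1 := hDe y
    have h2 := hB y hy.le
    have h3 : S * ‖y‖ ^ 2 ≤ S := by
      have : ‖y‖ ^ 2 ≤ 1 := by nlinarith [norm_nonneg y]
      nlinarith
    have h4 : |D y| ≤ |D y - e y| + |e y| := by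
      simpa using abs_add_le (D y - e y) (e y)
    change |D y| ≤ _
    have h5 : |e y| ≤ B := h2
    linarith
  let L : StrongDual ℝ H := Dh.toRealLinearMap hcont
  refine ⟨(InnerProductSpace.toDual ℝ H).symm L, fun y => ?_⟩
  rw [InnerProductSpace.toDual_symm_apply, abs_sub_comm]
  exact hDe y

/-- Tsar'kov's theorem: Hilbert-space valued Lipschitz maps extend from subsets of a normed space
whose norm is uniformly smooth of power type `2`. -/
lemma exists_lipschitz_extension {E H : Type*} [NormedAddCommGroup E] [NormedSpace ℝ E]
    [NormedAddCommGroup H] [InnerProductSpace ℝ H] [CompleteSpace H] {S : ℝ} (hS : 1 ≤ S)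
    (hE : ∀ a b : E, ‖a + b‖ ^ 2 + ‖a - b‖ ^ 2 ≤ 2 * ‖a‖ ^ 2 + 2 * S * ‖b‖ ^ 2)
    (N : Set E) (f : E → H) (hf : ∀ x ∈ N, ∀ y ∈ N, ‖f x - f y‖ ≤ ‖x - y‖) :
    ∃ F : E → H, (∀ x ∈ N, F x = f x) ∧ ∀ x y, ‖F x - F y‖ ≤ 6 * S * ‖x - y‖ := by
  rcases N.eq_empty_or_nonempty with rfl | ⟨z₀, hz₀⟩
  · exact ⟨fun _ => 0, by simp, fun x y => by simp; positivity⟩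
  let up : E → E → H → ℝ := fun z x y => inner ℝ (f z) y + (‖x - z‖ ^ 2 + ‖y‖ ^ 2)
  let lo : E → E → H → ℝ := fun z x y => inner ℝ (f z) y - (‖x - z‖ ^ 2 + ‖y‖ ^ 2)
  let Fam : Set (E → H → ℝ) :=
    {v | SecondDiffBound S v ∧ ∀ z ∈ N, ∀ x y, v x y ≤ up z x y}
  have hH : ∀ a b : H, ‖a + b‖ ^ 2 + ‖a - b‖ ^ 2 ≤ 2 * ‖a‖ ^ 2 + 2 * S * ‖b‖ ^ 2 := by
    intro a b
    have := parallelogram_law_with_norm ℝ a b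
    nlinarith [sq_nonneg ‖b‖]
  have hup : ∀ z x y h k, up z (x + h) (y + k) + up z (x - h) (y - k) ≤
      2 * up z x y + 2 * S * (‖h‖ ^ 2 + ‖k‖ ^ 2) := by
    intro z x y h k
    have h1 := hE (x - z) h
    have h2 := hH y k
    have e1 : x + h - z = x - z + h := by abel
    have e2 : x - h - z = x - z - h := by abel
    simp only [up, inner_add_right, inner_sub_right, e1, e2]
    linarith
  have hlo : ∀ z ∈ N, lo z ∈ Fam := by
    intro z hz
    refine ⟨fun x y h k => ?_, fun z' hz' x y => ?_⟩
    · have h1 := hE (x - z) h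
      have h2 := hH y k
      have e1 : x + h - z = x - z + h := by abel
      have e2 : x - h - z = x - z - h := by abel
      simp only [lo, inner_add_right, inner_sub_right, e1, e2]
      linarith
    · have h1 : inner ℝ (f z - f z') y ≤ ‖f z - f z'‖ * ‖y‖ := real_inner_le_norm _ _
      have h2 := hf z hz z' hz'
      have h3 : ‖z - z'‖ ≤ ‖x - z‖ + ‖x - z'‖ := by
        rw [norm_sub_rev x z]
        exact norm_sub_le_norm_sub_add_norm_sub z x z'
      have h4 : ‖f z - f z'‖ * ‖y‖ ≤ (‖x - z‖ + ‖x - z'‖) * ‖y‖ :=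
        mul_le_mul_of_nonneg_right (h2.trans h3) (norm_nonneg _)
      rw [inner_sub_left] at h1
      simp only [lo, up]
      nlinarith [sq_nonneg (‖x - z‖ - ‖y‖), sq_nonneg (‖x - z'‖ - ‖y‖)]
  let U : E → H → ℝ := fun x y => ⨆ v : Fam, (v : E → H → ℝ) x y
  have : Nonempty Fam := ⟨⟨lo z₀, hlo z₀ hz₀⟩⟩
  have hbdd : ∀ x y, BddAbove (Set.range fun v : Fam => (v : E → H → ℝ) x y) := fun x y =>
    ⟨up z₀ x y, by rintro _ ⟨v, rfl⟩; exact v.2.2 z₀ hz₀ x y⟩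
  have hle : ∀ v ∈ Fam, ∀ x y, v x y ≤ U x y := fun v hv x y =>
    le_ciSup (hbdd x y) (⟨v, hv⟩ : Fam)
  have hUup : ∀ z ∈ N, ∀ x y, U x y ≤ up z x y := fun z hz x y =>
    ciSup_le fun v => v.2.2 z hz x y
  have hUconv : SecondDiffBound S U := by
    intro x y h k
    have : U x y ≤ (U (x + h) (y + k) + U (x - h) (y - k) +
        2 * S * (‖h‖ ^ 2 + ‖k‖ ^ 2)) / 2 := by
      refine ciSup_le fun v => ?_
      have h1 := v.2.1 x y h k
      have h2 := hle v v.2 (x + h) (y + k)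
      have h3 := hle v v.2 (x - h) (y - k)
      linarith
    linarith
  have hUconc : ∀ x y h k, U (x + h) (y + k) + U (x - h) (y - k) ≤
      2 * U x y + 2 * S * (‖h‖ ^ 2 + ‖k‖ ^ 2) := by
    intro x y h k
    have hmem : (fun x y => (U (x + h) (y + k) + U (x - h) (y - k)) / 2 -
        S * (‖h‖ ^ 2 + ‖k‖ ^ 2)) ∈ Fam := by
      refine ⟨fun x' y' h' k' => ?_, fun z hz x' y' => ?_⟩
      · have h1 := hUconv (x' + h) (y' + k) h' k'
        have h2 := hUconv (x' - h) (y' - k) h' k'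
        have e1 : x' + h' + h = x' + h + h' := by abel
        have e2 : x' + h' - h = x' - h + h' := by abel
        have e3 : x' - h' + h = x' + h - h' := by abel
        have e4 : x' - h' - h = x' - h - h' := by abel
        have e5 : y' + k' + k = y' + k + k' := by abel
        have e6 : y' + k' - k = y' - k + k' := by abel
        have e7 : y' - k' + k = y' + k - k' := by abel
        have e8 : y' - k' - k = y' - k - k' := by abel
        simp only [e1, e2, e3, e4, e5, e6, e7, e8]
        have hz : 0 ≤ S * (‖h‖ ^ 2 + ‖k‖ ^ 2) := by positivity
        linarith
      · have h1 := hUup z hz (x' + h) (y' + k)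
        have h2 := hUup z hz (x' - h) (y' - k)
        have h3 := hup z x' y' h k
        linarith
    have := hle _ hmem x y
    linarith
  have hUabs : ∀ x y h k, |U (x + h) (y + k) + U (x - h) (y - k) - 2 * U x y| ≤
      2 * S * (‖h‖ ^ 2 + ‖k‖ ^ 2) := fun x y h k =>
    abs_le.2 ⟨by linarith [hUconv x y h k], by linarith [hUconc x y h k]⟩
  have hgrad : ∀ x, ∃ g : H, ∀ y, |U x y - U x 0 - inner ℝ g y| ≤ S * ‖y‖ ^ 2 := by
    intro x
    refine exists_gradient (U x) S (2 * (‖f z₀‖ + (‖x - z₀‖ ^ 2 + 1))) (by linarith)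
      (fun y k => ?_) fun y hy => ?_
    · simpa using hUabs x y 0 k
    · have hb : ∀ y : H, ‖y‖ ≤ 1 → |U x y| ≤ ‖f z₀‖ + (‖x - z₀‖ ^ 2 + 1) := by
        intro y hy
        have h1 := hUup z₀ hz₀ x y
        have h2 := hle _ (hlo z₀ hz₀) x y
        have h3 : |inner ℝ (f z₀) y| ≤ ‖f z₀‖ * ‖y‖ := abs_real_inner_le_norm _ _
        have h4 : ‖f z₀‖ * ‖y‖ ≤ ‖f z₀‖ := mul_le_of_le_one_right (norm_nonneg _) hy
        have h5 : ‖y‖ ^ 2 ≤ 1 := by nlinarith [norm_nonneg y]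
        simp only [up, lo] at h1 h2
        have h6 := abs_le.1 h3
        exact abs_le.2 ⟨by linarith, by linarith⟩
      have h1 := abs_le.1 (hb y hy)
      have h2 := abs_le.1 (hb 0 (by simp))
      exact abs_le.2 ⟨by linarith, by linarith⟩
  choose F hF using hgrad
  have key : ∀ (w : H) (C t : ℝ), 0 ≤ t → (∀ y, inner ℝ w y ≤ C * (t ^ 2 + ‖y‖ ^ 2)) →
      ‖w‖ ≤ 2 * C * t := by
    intro w C t ht hw
    have hscale : ∀ r : ℝ, r * ‖w‖ ^ 2 ≤ C * (t ^ 2 + r ^ 2 * ‖w‖ ^ 2) := by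
      intro r
      have := hw (r • w)
      rwa [inner_smul_right, real_inner_self_eq_norm_sq, norm_smul, mul_pow, Real.norm_eq_abs,
        sq_abs] at this
    rcases (norm_nonneg w).eq_or_lt with h0 | hpos
    · rw [← h0]
      have hC : 0 ≤ C * t ^ 2 := by simpa using hw 0
      rcases ht.eq_or_lt with rfl | htp
      · simp
      · have : 0 ≤ C := nonneg_of_mul_nonneg_left hC (by positivity)
        positivity
    · have hCt := hscale (t / ‖w‖)
      have e1 : t / ‖w‖ * ‖w‖ ^ 2 = t * ‖w‖ := by field_simp
      have e2 : (t / ‖w‖) ^ 2 * ‖w‖ ^ 2 = t ^ 2 := by field_simp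
      rw [e1, e2] at hCt
      rcases ht.eq_or_lt with rfl | htp
      · exfalso
        have hC : 0 < C := by
          have h := hscale 1
          by_contra hn
          nlinarith [sq_nonneg ‖w‖, pow_pos hpos 2]
        have h := hscale (1 / (2 * C))
        have e3 : C * (0 ^ 2 + (1 / (2 * C)) ^ 2 * ‖w‖ ^ 2) =
          (1 / (2 * C)) * ‖w‖ ^ 2 / 2 := by field_simp; ring
        rw [e3] at h
        have : 0 < (1 / (2 * C)) * ‖w‖ ^ 2 := by positivity
        linarith
      · have : t * ‖w‖ ≤ t * (2 * C * t) := by linarith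
        exact le_of_mul_le_mul_left this htp
  refine ⟨F, fun z hz => ?_, fun x x' => ?_⟩
  · have hUz : ∀ y, |U z y - inner ℝ (f z) y| ≤ ‖y‖ ^ 2 := by
      intro y
      have h1 := hUup z hz z y
      have h2 := hle _ (hlo z hz) z y
      simp only [up, lo, sub_self, norm_zero] at h1 h2
      exact abs_le.2 ⟨by linarith, by linarith⟩
    have hU0 : U z 0 = 0 := by
      have := hUz 0
      simpa using this
    have h := key (F z - f z) (1 + S) 0 le_rfl fun y => by
      have h1 := abs_le.1 (hF z y)
      have h2 := abs_le.1 (hUz y)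
      rw [inner_sub_left]
      rw [hU0] at h1
      linarith
    have h' : ‖F z - f z‖ = 0 := le_antisymm (by simpa using h) (norm_nonneg _)
    exact sub_eq_zero.1 (norm_eq_zero.1 h')
  · have h := key (F x - F x') (3 * S) ‖x - x'‖ (norm_nonneg _) fun y => by
      have h1 := abs_le.1 (hF x y)
      have h2 := abs_le.1 (hF x' y)
      set h := (1 / 2 : ℝ) • (x - x') with hh
      set k := (1 / 2 : ℝ) • y with hk
      have h3 := abs_le.1 (hUabs ((1 / 2 : ℝ) • (x + x')) k h k)
      have h4 := abs_le.1 (hUabs ((1 / 2 : ℝ) • (x + x')) k h (-k))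
      have e1 : (1 / 2 : ℝ) • (x + x') + h = x := by rw [hh]; module
      have e2 : (1 / 2 : ℝ) • (x + x') - h = x' := by rw [hh]; module
      have e3 : k + k = y := by rw [hk]; module
      rw [e1, e2, e3, sub_self] at h3
      rw [e1, e2, add_neg_cancel, sub_neg_eq_add, e3, norm_neg] at h4
      have n1 : ‖h‖ = 1 / 2 * ‖x - x'‖ := by rw [hh, norm_smul]; norm_num
      have n2 : ‖k‖ = 1 / 2 * ‖y‖ := by rw [hk, norm_smul]; norm_num
      rw [n1, n2] at h3 h4
      rw [inner_sub_left]
      nlinarith [mul_nonneg (by linarith : 0 ≤ S) (sq_nonneg ‖x - x'‖),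
        mul_nonneg (by linarith : 0 ≤ S) (sq_nonneg ‖y‖)]
    linarith

lemma sq_exp_sub_exp_le (a b : ℝ) :
    (Real.exp a - Real.exp b) ^ 2 ≤ (a - b) ^ 2 * (Real.exp a ^ 2 + Real.exp b ^ 2) := by
  wlog h : b ≤ a generalizing a b
  · have := this b a (not_le.1 h).le
    linarith
  have h1 : Real.exp a - Real.exp b ≤ (a - b) * Real.exp a := by
    have h2 := Real.add_one_le_exp (b - a)
    have h3 : Real.exp b = Real.exp (b - a) * Real.exp a := by rw [← Real.exp_add]; congr 1; ring
    rw [h3]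
    nlinarith [Real.exp_pos a]
  have h0 : 0 ≤ Real.exp a - Real.exp b := sub_nonneg.2 (Real.exp_le_exp.2 h)
  have h4 := pow_le_pow_left₀ h0 h1 2
  rw [mul_pow] at h4
  nlinarith [mul_nonneg (sq_nonneg (a - b)) (sq_nonneg (Real.exp b))]

/-- A smooth quadratic partition of unity on a finite metric space, at scale `τ`. -/
lemma exists_quadratic_partition {X : Type*} [Fintype X] [MetricSpace X] {τ D : ℝ} (hτ : 0 < τ)
    (hD : Fintype.card X * Real.exp (-(2 * D)) ≤ 1 / 2) :
    ∃ ψ : X → X → ℝ, (∀ z x, 0 ≤ ψ z x) ∧ (∀ x, ∑ z, ψ z x ^ 2 = 1) ∧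
      (∀ x y, ∑ z, (ψ z x - ψ z y) ^ 2 ≤ 8 * (dist x y / τ) ^ 2) ∧
      ∀ x, 1 / 2 ≤ ∑ z with dist x z ≤ D * τ, ψ z x ^ 2 := by
  set Z : X → ℝ := fun x => ∑ w, Real.exp (-(2 * (dist x w / τ))) with hZ
  have hZ1 : ∀ x, 1 ≤ Z x := fun x => by
    have := Finset.single_le_sum (f := fun w => Real.exp (-(2 * (dist x w / τ))))
      (fun _ _ => (Real.exp_pos _).le) (Finset.mem_univ x)
    simpa using this
  have hZlip : ∀ x y, Real.log (Z x) ≤ Real.log (Z y) + 2 * (dist x y / τ) := by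
    intro x y
    have h : Z x ≤ Real.exp (2 * (dist x y / τ)) * Z y := by
      simp only [hZ, Finset.mul_sum, ← Real.exp_add]
      refine Finset.sum_le_sum fun w _ => Real.exp_le_exp.2 ?_
      have : dist y w / τ ≤ dist x y / τ + dist x w / τ := by
        rw [← add_div]
        exact div_le_div_of_nonneg_right (dist_triangle_left y w x) hτ.le
      linarith
    have h2 := Real.log_le_log (by linarith [hZ1 x]) h
    rw [Real.log_mul (Real.exp_pos _).ne' (by linarith [hZ1 y]), Real.log_exp] at h2
    linarith
  set α : X → X → ℝ := fun z x => -(dist x z / τ) - Real.log (Z x) / 2 with hα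
  have hsq : ∀ z x, Real.exp (α z x) ^ 2 = Real.exp (-(2 * (dist x z / τ))) / Z x := by
    intro z x
    rw [← Real.exp_nat_mul]
    have : ((2 : ℕ) : ℝ) * α z x = -(2 * (dist x z / τ)) - Real.log (Z x) := by
      simp only [hα]; push_cast; ring
    rw [this, Real.exp_sub, Real.exp_log (by linarith [hZ1 x])]
  have hsum : ∀ x, ∑ z, Real.exp (α z x) ^ 2 = 1 := by
    intro x
    simp_rw [hsq]
    rw [← Finset.sum_div]
    exact div_self (by have := hZ1 x; simp only [hZ] at this ⊢; linarith)
  refine ⟨fun z x => Real.exp (α z x), fun _ _ => (Real.exp_pos _).le, hsum, fun x y => ?_,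
    fun x => ?_⟩
  · have hα2 : ∀ z, (α z x - α z y) ^ 2 ≤ 4 * (dist x y / τ) ^ 2 := by
      intro z
      have h1 : dist y z / τ ≤ dist x y / τ + dist x z / τ := by
        rw [← add_div]
        exact div_le_div_of_nonneg_right (dist_triangle_left y z x) hτ.le
      have h2 : dist x z / τ ≤ dist x y / τ + dist y z / τ := by
        rw [← add_div]
        exact div_le_div_of_nonneg_right (dist_triangle x y z) hτ.le
      have h3 := hZlip x y
      have h4 := hZlip y x
      rw [dist_comm y x] at h4
      have h5 : |α z x - α z y| ≤ 2 * (dist x y / τ) := by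
        simp only [hα]
        exact abs_le.2 ⟨by linarith, by linarith⟩
      have h6 := pow_le_pow_left₀ (abs_nonneg _) h5 2
      rw [sq_abs] at h6
      linarith
    calc ∑ z, (Real.exp (α z x) - Real.exp (α z y)) ^ 2
        ≤ ∑ z, 4 * (dist x y / τ) ^ 2 * (Real.exp (α z x) ^ 2 + Real.exp (α z y) ^ 2) :=
          Finset.sum_le_sum fun z _ => (sq_exp_sub_exp_le _ _).trans
            (mul_le_mul_of_nonneg_right (hα2 z) (by positivity))
      _ = 8 * (dist x y / τ) ^ 2 := by
          rw [← Finset.mul_sum, Finset.sum_add_distrib, hsum, hsum]; ring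
  · have h := Finset.sum_filter_add_sum_filter_not Finset.univ (fun z => dist x z ≤ D * τ)
      fun z => Real.exp (α z x) ^ 2
    rw [hsum] at h
    have h2 : ∑ z with ¬ dist x z ≤ D * τ, Real.exp (α z x) ^ 2 ≤ 1 / 2 := by
      calc ∑ z with ¬ dist x z ≤ D * τ, Real.exp (α z x) ^ 2
          ≤ ∑ z with ¬ dist x z ≤ D * τ, Real.exp (-(2 * D)) := by
            refine Finset.sum_le_sum fun z hz => ?_
            rw [hsq]
            refine (div_le_self (Real.exp_pos _).le (hZ1 x)).trans (Real.exp_le_exp.2 ?_)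
            have hz' := (Finset.mem_filter.1 hz).2
            have : D ≤ dist x z / τ := (le_div_iff₀ hτ).2 (not_le.1 hz').le
            linarith
        _ ≤ Fintype.card X * Real.exp (-(2 * D)) := by
            rw [Finset.sum_const, nsmul_eq_mul]
            refine mul_le_mul_of_nonneg_right ?_ (Real.exp_pos _).le
            exact_mod_cast Finset.card_le_univ _
        _ ≤ 1 / 2 := hD
    linarith

/-- The number of points in a closed ball of a finite metric space. -/
def ballCount {X : Type*} [Fintype X] [MetricSpace X] (u : X) (r : ℝ) : ℕ :=
  (Finset.univ.filter fun w => dist u w ≤ r).card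

lemma exists_separated_net {X : Type*} [Fintype X] [MetricSpace X] (S : Set X) (δ : ℝ) :
    ∃ N : Finset X, (∀ u ∈ N, u ∈ S) ∧ (∀ u ∈ N, ∀ v ∈ N, u ≠ v → δ < dist u v) ∧
      (0 ≤ δ → ∀ x ∈ S, ∃ u ∈ N, dist x u ≤ δ) := by
  classical
  let P : Finset (Finset X) := Finset.univ.filter fun N =>
    (∀ u ∈ N, u ∈ S) ∧ (∀ u ∈ N, ∀ v ∈ N, u ≠ v → δ < dist u v)
  obtain ⟨N, hN, hmax⟩ := P.exists_max_image Finset.card ⟨∅, by simp [P]⟩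
  simp only [P, Finset.mem_filter, Finset.mem_univ, true_and] at hN hmax
  refine ⟨N, hN.1, hN.2, fun hδ x hx => ?_⟩
  by_contra hcon
  push Not at hcon
  have hxN : x ∉ N := fun h => by
    have := hcon x h
    rw [dist_self] at this
    linarith
  have := hmax (insert x N) ⟨fun u hu => ?_, fun u hu v hv huv => ?_⟩
  · rw [Finset.card_insert_of_notMem hxN] at this
    omega
  · rcases Finset.mem_insert.1 hu with rfl | hu
    · exact hx
    · exact hN.1 u hu
  · rcases Finset.mem_insert.1 hu with rfl | hu' <;> rcases Finset.mem_insert.1 hv with rfl | hv'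
    · exact absurd rfl huv
    · exact hcon v hv'
    · rw [dist_comm]; exact hcon u hu'
    · exact hN.2 u hu' v hv' huv

/-- A separated set of bounded diameter has few points if its points have balls that are not
much smaller than larger concentric balls. -/
lemma card_le_of_ballCount_le {X : Type*} [Fintype X] [MetricSpace X] (N : Finset X) (r R : ℝ)
    (K : ℕ) (hr : 0 ≤ r) (hsep : ∀ u ∈ N, ∀ v ∈ N, u ≠ v → 2 * r < dist u v)
    (hdiam : ∀ u ∈ N, ∀ v ∈ N, dist u v + r ≤ R)
    (hK : ∀ u ∈ N, ballCount u R ≤ K * ballCount u r) : N.card ≤ K := by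
  classical
  rcases N.eq_empty_or_nonempty with rfl | hne
  · simp
  obtain ⟨u, hu, hmin⟩ := N.exists_min_image (fun u => ballCount u r) hne
  have h1 : (N.biUnion fun v => Finset.univ.filter fun w => dist v w ≤ r).card =
      ∑ v ∈ N, ballCount v r := by
    refine Finset.card_biUnion fun v hv w hw hvw => ?_
    rw [Function.onFun, Finset.disjoint_left]
    intro x hx hx'
    simp only [Finset.mem_filter, Finset.mem_univ, true_and] at hx hx'
    have := hsep v hv w hw hvw
    have := dist_triangle_right v w x
    linarith
  have h2 : (N.biUnion fun v => Finset.univ.filter fun w => dist v w ≤ r).card ≤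
      ballCount u R := by
    refine Finset.card_le_card fun x hx => ?_
    simp only [Finset.mem_biUnion, Finset.mem_filter, Finset.mem_univ, true_and] at hx ⊢
    obtain ⟨v, hv, hvx⟩ := hx
    have := dist_triangle u v x
    linarith [hdiam u hu v hv]
  have h3 : N.card * ballCount u r ≤ ∑ v ∈ N, ballCount v r := by
    rw [← smul_eq_mul]
    exact Finset.card_nsmul_le_sum _ _ _ hmin
  have hpos : 0 < ballCount u r :=
    Finset.card_pos.2 ⟨u, by simp [hr]⟩
  have h4 := hK u hu
  refine Nat.le_of_mul_le_mul_right ?_ hpos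
  omega

/-- Finite subsets of balls of `E` admit Lipschitz maps into Hilbert space, defined on all of `E`,
with a lower bound on the images of distances that depends on the cardinality. -/
def HasLocalMaps (E : Type*) [NormedAddCommGroup E] (a θ c : ℝ) : Prop :=
  ∀ (m : ℕ) (z : E) (R : ℝ) (N : Set E), 1 ≤ m → 0 < R → N.Finite → N.ncard ≤ 2 ^ m →
    N ⊆ Metric.closedBall z R → ∃ F : E → SeqL2, (∀ x y, ‖F x - F y‖ ≤ ‖x - y‖) ∧
      ∀ u ∈ N, ∀ v ∈ N, c * ‖u - v‖ ^ (1 + a) / (R ^ a * (m : ℝ) ^ θ) ≤ ‖F u - F v‖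

/-- Gluing maps to the sphere by a quadratic partition of unity. -/
lemma exists_glued_sphere_map {X : Type*} [Fintype X] [MetricSpace X] {τ D h : ℝ}
    (hτ : 0 < τ) (hh : 0 < h) (hhτ : h ≤ τ)
    (hD : Fintype.card X * Real.exp (-(2 * D)) ≤ 1 / 2) (G : X → X → SeqL2)
    (hG1 : ∀ z x, ‖G z x‖ = 1) (hG : ∀ z x y, ‖G z x - G z y‖ ≤ dist x y / h) :
    ∃ Φ : X → SeqL2, (∀ x, ‖Φ x‖ = 1) ∧ (∀ x y, ‖Φ x - Φ y‖ ≤ 5 * (dist x y / h)) ∧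
      ∀ x y, (∀ z, dist x z ≤ D * τ → inner ℝ (G z x) (G z y) ≤ 1 - sphereGap) →
        inner ℝ (Φ x) (Φ y) ≤ 1 - sphereGap / 4 := by
  obtain ⟨ψ, hψ0, hψ1, hψl, hψn⟩ := exists_quadratic_partition (X := X) hτ hD
  obtain ⟨Φ, hΦi, hΦn⟩ := exists_direct_sum fun z x => ψ z x • G z x
  have hΦi' : ∀ x y, inner ℝ (Φ x) (Φ y) = ∑ z, ψ z x * ψ z y * inner ℝ (G z x) (G z y) := by
    intro x y
    rw [hΦi]
    refine Finset.sum_congr rfl fun z _ => ?_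
    rw [real_inner_smul_left, real_inner_smul_right]
    ring
  refine ⟨Φ, fun x => ?_, fun x y => ?_, fun x y hxy => ?_⟩
  · have h1 : ‖Φ x‖ ^ 2 = 1 := by
      rw [← real_inner_self_eq_norm_sq, hΦi', ← hψ1 x]
      refine Finset.sum_congr rfl fun z _ => ?_
      rw [real_inner_self_eq_norm_sq, hG1]
      ring
    nlinarith [norm_nonneg (Φ x)]
  · have hterm : ∀ z, ‖ψ z x • G z x - ψ z y • G z y‖ ^ 2 ≤
        2 * (ψ z x - ψ z y) ^ 2 + 2 * (dist x y / h) ^ 2 * ψ z y ^ 2 := by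
      intro z
      have h1 : ψ z x • G z x - ψ z y • G z y =
          (ψ z x - ψ z y) • G z x + ψ z y • (G z x - G z y) := by module
      have h2 : ‖ψ z x • G z x - ψ z y • G z y‖ ≤ |ψ z x - ψ z y| + ψ z y * (dist x y / h) := by
        rw [h1]
        refine (norm_add_le _ _).trans ?_
        rw [norm_smul, norm_smul, hG1, mul_one, Real.norm_eq_abs, Real.norm_eq_abs,
          abs_of_nonneg (hψ0 z y)]
        gcongr
        · exact hψ0 z y
        · exact hG z x y
      have h3 := pow_le_pow_left₀ (norm_nonneg _) h2 2
      have h4 := sq_abs (ψ z x - ψ z y)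
      nlinarith [sq_nonneg (|ψ z x - ψ z y| - ψ z y * (dist x y / h))]
    have h1 : ‖Φ x - Φ y‖ ^ 2 ≤ 16 * (dist x y / τ) ^ 2 + 2 * (dist x y / h) ^ 2 := by
      rw [hΦn]
      refine (Finset.sum_le_sum fun z _ => hterm z).trans ?_
      rw [Finset.sum_add_distrib, ← Finset.mul_sum, ← Finset.mul_sum, hψ1]
      linarith [hψl x y]
    have h2 : dist x y / τ ≤ dist x y / h := by gcongr
    have h3 : 0 ≤ dist x y / τ := by positivity
    have h4 := pow_le_pow_left₀ h3 h2 2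
    refine le_of_sq_le_sq ?_ (by positivity)
    nlinarith [sq_nonneg (dist x y / h)]
  · have hηp := sphereGap_pos
    have hη1 := sphereGap_le_one
    have hin : ∀ z, inner ℝ (G z x) (G z y) ≤ 1 := fun z => by
      have := real_inner_le_norm (G z x) (G z y)
      rwa [hG1, hG1, one_mul] at this
    have hprod : ∀ z, ψ z x * ψ z y = (ψ z x ^ 2 + ψ z y ^ 2 - (ψ z x - ψ z y) ^ 2) / 2 :=
      fun z => by ring
    have hterm : ∀ z, ψ z x * ψ z y * inner ℝ (G z x) (G z y) ≤ ψ z x * ψ z y -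
        if dist x z ≤ D * τ then sphereGap * (ψ z x * ψ z y) else 0 := by
      intro z
      have hnn : 0 ≤ ψ z x * ψ z y := mul_nonneg (hψ0 z x) (hψ0 z y)
      split_ifs with hz
      · have := mul_le_mul_of_nonneg_left (hxy z hz) hnn
        linarith
      · have := mul_le_mul_of_nonneg_left (hin z) hnn
        linarith
    have h1 : ∑ z, ψ z x * ψ z y = 1 - (∑ z, (ψ z x - ψ z y) ^ 2) / 2 := by
      simp_rw [hprod]
      rw [← Finset.sum_div, Finset.sum_sub_distrib, Finset.sum_add_distrib, hψ1, hψ1]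
      ring
    have h2 : (∑ z with dist x z ≤ D * τ, ψ z x ^ 2) / 2 -
        (∑ z, (ψ z x - ψ z y) ^ 2) / 2 ≤ ∑ z with dist x z ≤ D * τ, ψ z x * ψ z y := by
      have h3 : ∑ z with dist x z ≤ D * τ, (ψ z x - ψ z y) ^ 2 ≤ ∑ z, (ψ z x - ψ z y) ^ 2 :=
        Finset.sum_le_sum_of_subset_of_nonneg (Finset.filter_subset _ _)
          fun _ _ _ => sq_nonneg _
      have h4 : ∑ z with dist x z ≤ D * τ, (ψ z x ^ 2 - (ψ z x - ψ z y) ^ 2) / 2 ≤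
          ∑ z with dist x z ≤ D * τ, ψ z x * ψ z y :=
        Finset.sum_le_sum fun z _ => by rw [hprod]; linarith [sq_nonneg (ψ z y)]
      rw [← Finset.sum_div, Finset.sum_sub_distrib] at h4
      linarith
    rw [hΦi']
    refine (Finset.sum_le_sum fun z _ => hterm z).trans ?_
    rw [Finset.sum_sub_distrib, ← Finset.sum_filter, ← Finset.mul_sum, h1]
    have h5 := hψn x
    have h6 : 0 ≤ ∑ z, (ψ z x - ψ z y) ^ 2 := Finset.sum_nonneg fun _ _ => sq_nonneg _
    have h7 := mul_le_mul_of_nonneg_left h2 hηp.le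
    nlinarith

/-- A map to the sphere that separates points of `S` at distances comparable to `τ`. -/
lemma exists_single_scale_map {X E : Type*} [Fintype X] [MetricSpace X] [NormedAddCommGroup E]
    {a θ c : ℝ} (hE : HasLocalMaps E a θ c) (ha : 0 ≤ a) (hc : 0 < c) (e : X → E)
    (he : ∀ x y, ‖e x - e y‖ = dist x y) {D τ γ A : ℝ} {m : ℕ} (hm : 1 ≤ m) (hD0 : 0 ≤ D)
    (hτ : 0 < τ) (hγ : 0 < γ) (hγ1 : γ ≤ 1 / 16)
    (hD : Fintype.card X * Real.exp (-(2 * D)) ≤ 1 / 2)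
    (hγc : 9 * γ ≤ c * (1 / 2) ^ (1 + a) / ((D + 3) ^ a * (m : ℝ) ^ θ))
    (hA : 2 * (D + 3) + 1 ≤ A) (S : Set X)
    (hS : ∀ u ∈ S, ballCount u (A * τ) ≤ 2 ^ m * ballCount u (2 * (γ * τ))) :
    ∃ Φ : X → SeqL2, (∀ x, ‖Φ x‖ = 1) ∧ (∀ x y, ‖Φ x - Φ y‖ ≤ 5 * (dist x y / (γ * τ))) ∧
      ∀ x ∈ S, ∀ y ∈ S, τ ≤ dist x y → dist x y ≤ 2 * τ →
        inner ℝ (Φ x) (Φ y) ≤ 1 - sphereGap / 4 := by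
  classical
  set h := γ * τ with hh
  have hhp : 0 < h := by positivity
  have hhτ : h ≤ τ / 16 := by
    rw [hh]; nlinarith
  obtain ⟨N, hNS, hNsep, hNnet⟩ := exists_separated_net S (4 * h)
  have hR : 0 < (D + 3) * τ := by positivity
  have hinj : Function.Injective e := fun x y hxy => by
    have := he x y
    rw [hxy, sub_self, norm_zero] at this
    exact dist_eq_zero.1 this.symm
  have hlocal : ∀ z : X, ∃ F : E → SeqL2, (∀ x y, ‖F x - F y‖ ≤ ‖x - y‖) ∧
      ∀ u ∈ N, ∀ v ∈ N, dist u z ≤ (D + 3) * τ → dist v z ≤ (D + 3) * τ →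
        c * dist u v ^ (1 + a) / (((D + 3) * τ) ^ a * (m : ℝ) ^ θ) ≤ ‖F (e u) - F (e v)‖ := by
    intro z
    set Nz := N.filter fun u => dist u z ≤ (D + 3) * τ with hNz
    have hcard : Nz.card ≤ 2 ^ m := by
      refine card_le_of_ballCount_le Nz (2 * h) (A * τ) _ (by positivity)
        (fun u hu v hv huv => ?_) (fun u hu v hv => ?_) fun u hu => ?_
      · have := hNsep u (Finset.mem_filter.1 hu).1 v (Finset.mem_filter.1 hv).1 huv
        linarith
      · have h1 := (Finset.mem_filter.1 hu).2
        have h2 := (Finset.mem_filter.1 hv).2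
        have h3 := dist_triangle_right u v z
        nlinarith
      · exact hS u (hNS u (Finset.mem_filter.1 hu).1)
    obtain ⟨F, hF, hF'⟩ := hE m (e z) ((D + 3) * τ) (e '' Nz) hm hR
      (Nz.finite_toSet.image e)
      (by rw [Set.ncard_image_of_injective _ hinj, Set.ncard_coe_finset]; exact hcard)
      (by
        rintro _ ⟨u, hu, rfl⟩
        rw [Metric.mem_closedBall, dist_eq_norm, he]
        exact (Finset.mem_filter.1 hu).2)
    refine ⟨F, hF, fun u hu v hv huz hvz => ?_⟩
    have := hF' (e u) ⟨u, by simp [hNz, hu, huz], rfl⟩ (e v) ⟨v, by simp [hNz, hv, hvz], rfl⟩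
    rwa [he] at this
  choose F hFl hFs using hlocal
  choose G hG1 hGl hGs using fun z => exists_sphere_map fun x => h⁻¹ • F z (e x)
  have hFh : ∀ z x y, ‖h⁻¹ • F z (e x) - h⁻¹ • F z (e y)‖ = ‖F z (e x) - F z (e y)‖ / h := by
    intro z x y
    rw [← smul_sub, norm_smul, Real.norm_of_nonneg (by positivity)]
    ring
  have hFd : ∀ z x y, ‖F z (e x) - F z (e y)‖ ≤ dist x y := fun z x y => by
    rw [← he]; exact hFl z _ _
  obtain ⟨Φ, hΦ1, hΦl, hΦs⟩ := exists_glued_sphere_map hτ hhp (by linarith) hD G hG1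
    fun z x y => by
      refine (hGl z x y).trans ?_
      rw [hFh]
      exact div_le_div_of_nonneg_right (hFd z x y) hhp.le
  refine ⟨Φ, hΦ1, hΦl, fun x hx y hy hxy1 hxy2 => hΦs x y fun z hz => hGs z x y ?_⟩
  rw [hFh, one_le_div hhp]
  obtain ⟨u, hu, hxu⟩ := hNnet (by positivity) x hx
  obtain ⟨v, hv, hyv⟩ := hNnet (by positivity) y hy
  have hxz := hz
  have huz : dist u z ≤ (D + 3) * τ := by
    have := dist_triangle_left u z x
    nlinarith
  have hvz : dist v z ≤ (D + 3) * τ := by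
    have := dist_triangle_left v z y
    have := dist_triangle_left y z x
    nlinarith
  have huv : τ / 2 ≤ dist u v := by
    have h1 := dist_triangle4 x u v y
    rw [dist_comm v y] at h1
    linarith
  have h1 := hFs z u hu v hv huz hvz
  have h2 : 9 * h ≤ c * dist u v ^ (1 + a) / (((D + 3) * τ) ^ a * (m : ℝ) ^ θ) := by
    have hm0 : (0 : ℝ) < m := by exact_mod_cast hm
    calc 9 * h = 9 * γ * τ := by rw [hh]; ring
      _ ≤ c * (1 / 2) ^ (1 + a) / ((D + 3) ^ a * (m : ℝ) ^ θ) * τ := by gcongr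
      _ = c * (τ / 2) ^ (1 + a) / (((D + 3) * τ) ^ a * (m : ℝ) ^ θ) := by
          rw [Real.mul_rpow (by positivity) hτ.le, show τ / 2 = (1 / 2) * τ by ring,
            Real.mul_rpow (by norm_num) hτ.le, Real.rpow_add hτ, Real.rpow_one]
          have : 0 < τ ^ a := by positivity
          have : 0 < (D + 3) ^ a := by positivity
          have : 0 < (m : ℝ) ^ θ := by positivity
          field_simp
      _ ≤ _ := by gcongr
  have h3 := hFd z x u
  have h4 := hFd z y v
  have h5 : ‖F z (e u) - F z (e v)‖ ≤ ‖F z (e x) - F z (e u)‖ + ‖F z (e x) - F z (e y)‖ +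
      ‖F z (e y) - F z (e v)‖ := by
    have h6 : F z (e u) - F z (e v) = -(F z (e x) - F z (e u)) + (F z (e x) - F z (e y)) +
      (F z (e y) - F z (e v)) := by abel
    rw [h6, ← norm_neg (F z (e x) - F z (e u))]
    exact norm_add₃_le
  linarith

lemma ballCount_pos {X : Type*} [Fintype X] [MetricSpace X] (u : X) {r : ℝ} (hr : 0 ≤ r) :
    0 < ballCount u r :=
  Finset.card_pos.2 ⟨u, by simp [hr]⟩

lemma ballCount_le_card {X : Type*} [Fintype X] [MetricSpace X] (u : X) (r : ℝ) :
    ballCount u r ≤ Fintype.card X := Finset.card_le_univ _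

lemma ballCount_le_ballCount {X : Type*} [Fintype X] [MetricSpace X] (u v : X) {r R : ℝ}
    (h : dist u v + r ≤ R) : ballCount v r ≤ ballCount u R := by
  refine Finset.card_le_card fun x hx => ?_
  simp only [Finset.mem_filter, Finset.mem_univ, true_and] at hx ⊢
  linarith [dist_triangle u v x]

lemma exists_cutoff {X : Type*} [MetricSpace X] (P : Set X) {h : ℝ} (hh : 0 < h) :
    ∃ ρ : X → ℝ, (∀ x, 0 ≤ ρ x) ∧ (∀ x, ρ x ≤ 1) ∧ (∀ x ∈ P, ρ x = 1) ∧
      (∀ x y, |ρ x - ρ y| ≤ dist x y / h) ∧ ∀ x, ρ x ≠ 0 → ∃ y ∈ P, dist x y < h := by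
  rcases P.eq_empty_or_nonempty with rfl | hP
  · exact ⟨fun _ => 0, by simp, by simp, by simp, fun x y => by simp; positivity, by simp⟩
  refine ⟨fun x => max 0 (1 - Metric.infDist x P / h), fun x => le_max_left _ _, fun x => ?_,
    fun x hx => ?_, fun x y => ?_, fun x hx => ?_⟩
  · refine max_le zero_le_one ?_
    have : 0 ≤ Metric.infDist x P / h := div_nonneg Metric.infDist_nonneg hh.le
    linarith
  · simp [Metric.infDist_zero_of_mem hx]
  · have h1 := Metric.infDist_le_infDist_add_dist (s := P) (x := x) (y := y)
    have h2 := Metric.infDist_le_infDist_add_dist (s := P) (x := y) (y := x)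
    rw [dist_comm y x] at h2
    have h3 : |Metric.infDist x P / h - Metric.infDist y P / h| ≤ dist x y / h := by
      rw [← sub_div, abs_div, abs_of_pos hh]
      exact div_le_div_of_nonneg_right (abs_le.2 ⟨by linarith, by linarith⟩) hh.le
    refine (abs_max_sub_max_le_max _ _ _ _).trans ?_
    have h4 : (1 - Metric.infDist x P / h) - (1 - Metric.infDist y P / h) =
      -(Metric.infDist x P / h - Metric.infDist y P / h) := by ring
    rw [h4, abs_neg, sub_self, abs_zero]
    exact max_le (by positivity) h3
  · refine (Metric.infDist_lt_iff hP).1 ?_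
    by_contra hcon
    have : 1 ≤ Metric.infDist x P / h := (one_le_div hh).2 (not_lt.1 hcon)
    exact hx (max_eq_left (by linarith))

lemma sum_two_pow_ite_le (K : ℕ) (t : ℝ) (ht : 0 ≤ t) :
    ∑ j ∈ Finset.range K, (if (2 : ℝ) ^ j < t then (2 : ℝ) ^ j else 0) ≤ 2 * t := by
  have key : ∀ K : ℕ, ∑ j ∈ Finset.range K, (if (2 : ℝ) ^ j < t then (2 : ℝ) ^ j else 0) ≤
      2 * t ∧ ∑ j ∈ Finset.range K, (if (2 : ℝ) ^ j < t then (2 : ℝ) ^ j else 0) ≤ 2 ^ K := by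
    intro K
    induction K with
    | zero => simp [ht]
    | succ K ih =>
      rw [Finset.sum_range_succ, pow_succ]
      split_ifs with h
      · exact ⟨by linarith, by linarith⟩
      · exact ⟨by linarith, by linarith [pow_pos (two_pos : (0 : ℝ) < 2) K]⟩
  exact (key K).1

lemma sum_shift_sub_le (g : ℕ → ℝ) (B : ℝ) (h0 : ∀ k, 0 ≤ g k) (hB : ∀ k, g k ≤ B) (N w : ℕ) :
    ∑ i ∈ Finset.range N, (g (i + w) - g i) ≤ w * B := by
  induction w with
  | zero => simp
  | succ w ih =>
    have h1 := Finset.sum_range_sub (fun i => g (i + w)) N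
    have h2 : ∑ i ∈ Finset.range N, (g (i + (w + 1)) - g i) =
        ∑ i ∈ Finset.range N, (g (i + 1 + w) - g (i + w)) +
          ∑ i ∈ Finset.range N, (g (i + w) - g i) := by
      rw [← Finset.sum_add_distrib]
      refine Finset.sum_congr rfl fun i _ => ?_
      have : i + (w + 1) = i + 1 + w := by ring
      rw [this]; ring
    rw [h2, h1]
    push_cast
    have := hB (N + w)
    have := h0 (0 + w)
    linarith

lemma exists_min_dist (X : Type*) [Fintype X] [MetricSpace X] :
    ∃ τ : ℝ, 0 < τ ∧ ∃ N : ℕ, ∀ x y : X, x ≠ y →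
      ∃ i < N, τ * 2 ^ i ≤ dist x y ∧ dist x y ≤ 2 * (τ * 2 ^ i) := by
  classical
  have h1 : ∃ τ : ℝ, 0 < τ ∧ ∀ x y : X, x ≠ y → τ ≤ dist x y := by
    let P : Finset (X × X) := Finset.univ.filter fun z => z.1 ≠ z.2
    rcases P.eq_empty_or_nonempty with hP | hP
    · refine ⟨1, one_pos, fun x y hxy => ?_⟩
      have : (x, y) ∈ P := by simp [P, hxy]
      simp [hP] at this
    · obtain ⟨z, hz, hmin⟩ := P.exists_min_image (fun z => dist z.1 z.2) hP
      simp only [P, Finset.mem_filter, Finset.mem_univ, true_and] at hz hmin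
      exact ⟨dist z.1 z.2, dist_pos.2 hz, fun x y hxy => hmin (x, y) hxy⟩
  obtain ⟨τ, hτ, hmin⟩ := h1
  obtain ⟨C, hC⟩ := (Set.finite_range fun z : X × X => dist z.1 z.2).bddAbove
  have hC' : ∀ x y : X, dist x y ≤ C := fun x y => hC ⟨(x, y), rfl⟩
  obtain ⟨N, hN⟩ := pow_unbounded_of_one_lt (C / τ) (one_lt_two (α := ℝ))
  refine ⟨τ, hτ, N, fun x y hxy => ?_⟩
  obtain ⟨i, hi1, hi2⟩ := exists_nat_pow_near ((one_le_div hτ).2 (hmin x y hxy))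
    (one_lt_two (α := ℝ))
  refine ⟨i, ?_, ?_, ?_⟩
  · have h3 : (2 : ℝ) ^ i < 2 ^ N :=
      hi1.trans_lt ((div_le_div_of_nonneg_right (hC' x y) hτ.le).trans_lt hN)
    exact (pow_lt_pow_iff_right₀ one_lt_two).1 h3
  · rw [le_div_iff₀ hτ] at hi1; linarith
  · rw [div_lt_iff₀ hτ, pow_succ] at hi2; linarith

/-- One scale and one level of the gluing construction. -/
lemma exists_localized_map {X : Type*} [Fintype X] [MetricSpace X] {τ γ η : ℝ} {b j : ℕ}
    (hτ : 0 < τ) (hγ : 0 < γ) (hγ1 : γ ≤ 1 / 16) (hb : (1 / 2) ^ b ≤ γ) (hη0 : 0 ≤ η)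
    (hη1 : η ≤ 1)
    (hΦ : ∃ Φ : X → SeqL2, (∀ x, ‖Φ x‖ = 1) ∧ (∀ x y, ‖Φ x - Φ y‖ ≤ 5 * (dist x y / (γ * τ))) ∧
      ∀ x y, ballCount x (2 ^ b * τ) ≤ 2 ^ 2 ^ j * ballCount x (2 * (γ * τ)) →
        ballCount y (2 ^ b * τ) ≤ 2 ^ 2 ^ j * ballCount y (2 * (γ * τ)) →
        τ ≤ dist x y → dist x y ≤ 2 * τ → inner ℝ (Φ x) (Φ y) ≤ 1 - η) :
    ∃ Ψ : X → SeqL2,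
      (∀ x y, ‖Ψ x - Ψ y‖ ^ 2 ≤ 36 * dist x y ^ 2 *
        ((if (2 : ℝ) ^ j < 2 * (Real.logb 2 (ballCount x (2 * 2 ^ b * τ)) -
            Real.logb 2 (ballCount x (1 / 2 ^ b * τ))) then 2 ^ j else 0) +
          if (2 : ℝ) ^ j < 2 * (Real.logb 2 (ballCount y (2 * 2 ^ b * τ)) -
            Real.logb 2 (ballCount y (1 / 2 ^ b * τ))) then 2 ^ j else 0)) ∧
      ∀ x y, ballCount x (2 ^ b * τ) ≤ 2 ^ 2 ^ j * ballCount x (2 * (γ * τ)) →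
        ballCount y (2 ^ b * τ) ≤ 2 ^ 2 ^ j * ballCount y (2 * (γ * τ)) →
        τ ≤ dist x y → dist x y ≤ 2 * τ →
        2 ^ 2 ^ j * ballCount y (2 * (γ * τ)) ^ 2 < ballCount y (2 ^ b * τ) ^ 2 →
        2 ^ j * γ ^ 2 * η * dist x y ^ 2 / 4 ≤ ‖Ψ x - Ψ y‖ ^ 2 := by
  obtain ⟨Φ, hΦ1, hΦl, hΦs⟩ := hΦ
  set h := γ * τ with hh
  have hhp : 0 < h := by positivity
  obtain ⟨ρ, hρ0, hρ1, hρP, hρl, hρa⟩ := exists_cutoff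
    {u : X | 2 ^ 2 ^ j * ballCount u (2 * h) ^ 2 < ballCount u (2 ^ b * τ) ^ 2} hhp
  have hscale : ∀ x y, ‖(√(2 ^ j) * h * ρ x) • Φ x - (√(2 ^ j) * h * ρ y) • Φ y‖ ^ 2 =
      2 ^ j * h ^ 2 * ‖ρ x • Φ x - ρ y • Φ y‖ ^ 2 := by
    intro x y
    rw [mul_smul _ (ρ x), mul_smul _ (ρ y), ← smul_sub, norm_smul, mul_pow, Real.norm_eq_abs, sq_abs, mul_pow,
      Real.sq_sqrt (by positivity)]
  have hact : ∀ x, ρ x ≠ 0 → (2 : ℝ) ^ j < 2 * (Real.logb 2 (ballCount x (2 * 2 ^ b * τ)) -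
      Real.logb 2 (ballCount x (1 / 2 ^ b * τ))) := by
    intro x hx
    obtain ⟨u, hu, hxu⟩ := hρa x hx
    rw [Set.mem_ofPred_eq] at hu
    have hb2 : (1 / 2 ^ b : ℝ) * τ ≤ h := by
      rw [hh]
      refine mul_le_mul_of_nonneg_right ?_ hτ.le
      rwa [one_div_pow] at hb
    have h1 : ballCount x (1 / 2 ^ b * τ) ≤ ballCount u (2 * h) :=
      ballCount_le_ballCount u x (by rw [dist_comm]; linarith)
    have h2 : ballCount u (2 ^ b * τ) ≤ ballCount x (2 * 2 ^ b * τ) := by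
      refine ballCount_le_ballCount x u ?_
      have h3 : h ≤ τ := by rw [hh]; nlinarith
      have h4 : τ ≤ 2 ^ b * τ := le_mul_of_one_le_left hτ.le (one_le_pow₀ one_le_two)
      linarith
    have hpos : 0 < ballCount x (1 / 2 ^ b * τ) := ballCount_pos x (by positivity)
    have hpos' : 0 < ballCount x (2 * 2 ^ b * τ) := ballCount_pos x (by positivity)
    have h3 : 2 ^ 2 ^ j * ballCount x (1 / 2 ^ b * τ) ^ 2 < ballCount x (2 * 2 ^ b * τ) ^ 2 :=
      calc 2 ^ 2 ^ j * ballCount x (1 / 2 ^ b * τ) ^ 2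
          ≤ 2 ^ 2 ^ j * ballCount u (2 * h) ^ 2 := by gcongr
        _ < ballCount u (2 ^ b * τ) ^ 2 := hu
        _ ≤ _ := by gcongr
    have h4 : (2 : ℝ) ^ 2 ^ j * (ballCount x (1 / 2 ^ b * τ) : ℝ) ^ 2 <
        (ballCount x (2 * 2 ^ b * τ) : ℝ) ^ 2 := by exact_mod_cast h3
    have hposR : (0 : ℝ) < ballCount x (1 / 2 ^ b * τ) := by exact_mod_cast hpos
    have h5 := Real.logb_lt_logb one_lt_two (by positivity) h4
    rw [Real.logb_mul (by positivity) (by positivity), Real.logb_pow, Real.logb_pow,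
      Real.logb_pow, Real.logb_self_eq_one one_lt_two] at h5
    push_cast at h5
    linarith
  have hlip : ∀ x y, ‖ρ x • Φ x - ρ y • Φ y‖ ≤ 6 * (dist x y / h) := by
    intro x y
    have h1 : ρ x • Φ x - ρ y • Φ y = (ρ x - ρ y) • Φ x + ρ y • (Φ x - Φ y) := by module
    rw [h1]
    refine (norm_add_le _ _).trans ?_
    rw [norm_smul, norm_smul, hΦ1, mul_one, Real.norm_eq_abs, Real.norm_eq_abs,
      abs_of_nonneg (hρ0 y)]
    have h2 := mul_le_of_le_one_left (norm_nonneg (Φ x - Φ y)) (hρ1 y)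
    linarith [hρl x y, hΦl x y]
  refine ⟨fun x => (√(2 ^ j) * h * ρ x) • Φ x, fun x y => ?_, fun x y hx hy hxy1 hxy2 hP => ?_⟩
  · rw [hscale]
    have hmain : 2 ^ j * h ^ 2 * ‖ρ x • Φ x - ρ y • Φ y‖ ^ 2 ≤ 36 * dist x y ^ 2 * 2 ^ j := by
      have h1 := pow_le_pow_left₀ (norm_nonneg _) (hlip x y) 2
      have h2 : (6 * (dist x y / h)) ^ 2 * h ^ 2 = 36 * dist x y ^ 2 := by
        field_simp; ring
      have h3 := mul_le_mul_of_nonneg_right h1 (sq_nonneg h)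
      rw [h2] at h3
      have h4 := mul_le_mul_of_nonneg_left h3 (by positivity : (0 : ℝ) ≤ 2 ^ j)
      linarith
    have hnn : ∀ u : X, (0 : ℝ) ≤ if (2 : ℝ) ^ j < 2 * (Real.logb 2 (ballCount u (2 * 2 ^ b * τ)) -
        Real.logb 2 (ballCount u (1 / 2 ^ b * τ))) then 2 ^ j else 0 := fun u => by
      split_ifs <;> positivity
    by_cases hxa : ρ x = 0
    · by_cases hya : ρ y = 0
      · rw [hxa, hya, zero_smul, zero_smul, sub_self, norm_zero]
        have := add_nonneg (hnn x) (hnn y)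
        have : (2 : ℝ) ^ j * h ^ 2 * 0 ^ 2 = 0 := by ring
        rw [this]
        exact mul_nonneg (by positivity) (add_nonneg (hnn x) (hnn y))
      · refine hmain.trans (mul_le_mul_of_nonneg_left ?_ (by positivity))
        rw [if_pos (hact y hya)]
        linarith [hnn x]
    · refine hmain.trans (mul_le_mul_of_nonneg_left ?_ (by positivity))
      rw [if_pos (hact x hxa)]
      linarith [hnn y]
  · rw [hscale, hρP y hP, one_smul]
    have h1 : η ≤ ‖ρ x • Φ x - Φ y‖ ^ 2 := by
      rw [norm_sub_sq_real, norm_smul, hΦ1, hΦ1, real_inner_smul_left, Real.norm_eq_abs, mul_one,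
        sq_abs]
      have h2 := mul_le_mul_of_nonneg_left (hΦs x y hx hy hxy1 hxy2) (hρ0 x)
      nlinarith [sq_nonneg (ρ x - (1 - η))]
    have h2 : (dist x y) ^ 2 / 4 ≤ τ ^ 2 := by
      have := pow_le_pow_left₀ dist_nonneg hxy2 2
      linarith
    calc 2 ^ j * γ ^ 2 * η * dist x y ^ 2 / 4 = 2 ^ j * γ ^ 2 * η * (dist x y ^ 2 / 4) := by ring
      _ ≤ 2 ^ j * γ ^ 2 * η * τ ^ 2 := by gcongr
      _ = 2 ^ j * h ^ 2 * η := by rw [hh]; ring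
      _ ≤ _ := by gcongr

/-- Gluing maps at different scales and levels. -/
lemma exists_glued_map {X : Type*} [Fintype X] [MetricSpace X] {γ : ℕ → ℝ} {η δ : ℝ} {b J : ℕ}
    (hcard : Fintype.card X ≤ 2 ^ 2 ^ J) (hγ : ∀ j, 0 < γ j) (hγ1 : ∀ j, γ j ≤ 1 / 16)
    (hγa : Antitone γ) (hb2 : 2 ≤ b) (hb : ∀ j ≤ J, (1 / 2) ^ b ≤ γ j) (hη0 : 0 ≤ η)
    (hη1 : η ≤ 1) (hδ : ∀ j ≤ J, δ ≤ 2 ^ j * γ j ^ 2)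
    (hΦ : ∀ τ : ℝ, 0 < τ → ∀ j ≤ J,
      ∃ Φ : X → SeqL2, (∀ x, ‖Φ x‖ = 1) ∧
      (∀ x y, ‖Φ x - Φ y‖ ≤ 5 * (dist x y / (γ j * τ))) ∧
      ∀ x y, ballCount x (2 ^ b * τ) ≤ 2 ^ 2 ^ j * ballCount x (2 * (γ j * τ)) →
        ballCount y (2 ^ b * τ) ≤ 2 ^ 2 ^ j * ballCount y (2 * (γ j * τ)) →
        τ ≤ dist x y → dist x y ≤ 2 * τ → inner ℝ (Φ x) (Φ y) ≤ 1 - η) :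
    ∃ Ψ : X → SeqL2,
      (∀ x y, ‖Ψ x - Ψ y‖ ^ 2 ≤ 288 * (2 * b + 1) * 2 ^ J * dist x y ^ 2) ∧
      ∀ x y, δ * η / 4 * dist x y ^ 2 ≤ ‖Ψ x - Ψ y‖ ^ 2 := by
  classical
  obtain ⟨τ, hτ, N, hN⟩ := exists_min_dist X
  have hex : ∀ k : Fin N × Fin (J + 1), _ := fun k =>
    exists_localized_map (by positivity : 0 < τ * 2 ^ (k.1 : ℕ)) (hγ k.2) (hγ1 k.2)
      (hb k.2 (Nat.lt_succ_iff.1 k.2.2)) hη0 hη1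
      (hΦ (τ * 2 ^ (k.1 : ℕ)) (by positivity) k.2 (Nat.lt_succ_iff.1 k.2.2))
  choose Ψ' hup hlow using hex
  obtain ⟨Ψ, -, hΨ⟩ := exists_direct_sum Ψ'
  refine ⟨Ψ, fun x y => ?_, fun x y => ?_⟩
  · have hside : ∀ x : X, ∑ k : Fin N × Fin (J + 1),
        (if (2 : ℝ) ^ (k.2 : ℕ) < 2 * (Real.logb 2 (ballCount x (2 * 2 ^ b * (τ * 2 ^ (k.1 : ℕ)))) -
            Real.logb 2 (ballCount x (1 / 2 ^ b * (τ * 2 ^ (k.1 : ℕ))))) then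
          (2 : ℝ) ^ (k.2 : ℕ) else 0) ≤ 4 * (2 * b + 1) * 2 ^ J := by
      intro x
      have hcard1 : ∀ r, 0 ≤ r → (1 : ℝ) ≤ ballCount x r := fun r hr => by
        exact_mod_cast ballCount_pos x hr
      set g : ℕ → ℝ := fun k => Real.logb 2 (ballCount x (1 / 2 ^ b * (τ * 2 ^ k))) with hg
      have hg0 : ∀ k, 0 ≤ g k := fun k =>
        Real.logb_nonneg one_lt_two (hcard1 _ (by positivity))
      have hgB : ∀ k, g k ≤ 2 ^ J := fun k => by
        have h1 : ((ballCount x (1 / 2 ^ b * (τ * 2 ^ k)) : ℕ) : ℝ) ≤ 2 ^ 2 ^ J := by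
          exact_mod_cast (ballCount_le_card x _).trans hcard
        have h2 := Real.logb_le_logb_of_le one_lt_two
          (by linarith [hcard1 (1 / 2 ^ b * (τ * 2 ^ k)) (by positivity)]) h1
        rw [Real.logb_pow, Real.logb_self_eq_one one_lt_two] at h2
        push_cast at h2
        linarith
      have hgs : ∀ k, Real.logb 2 (ballCount x (2 * 2 ^ b * (τ * 2 ^ k))) =
          g (k + (2 * b + 1)) := by
        intro k
        simp only [hg]
        congr 3
        rw [pow_add, pow_add, pow_mul']
        field_simp
      rw [Fintype.sum_prod_type]
      calc _ ≤ ∑ i : Fin N, 4 * (g ((i : ℕ) + (2 * b + 1)) - g i) := by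
            refine Finset.sum_le_sum fun i _ => ?_
            have hmono : g (i : ℕ) ≤ g ((i : ℕ) + (2 * b + 1)) := by
              refine Real.logb_le_logb_of_le one_lt_two
                (by linarith [hcard1 (1 / 2 ^ b * (τ * 2 ^ (i : ℕ))) (by positivity)]) ?_
              have : ballCount x (1 / 2 ^ b * (τ * 2 ^ (i : ℕ))) ≤
                  ballCount x (1 / 2 ^ b * (τ * 2 ^ ((i : ℕ) + (2 * b + 1)))) := by
                refine ballCount_le_ballCount x x ?_
                rw [dist_self, zero_add]
                gcongr
                · norm_num
                · omega
              exact_mod_cast this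
            have h1 := sum_two_pow_ite_le (J + 1) (2 * (g ((i : ℕ) + (2 * b + 1)) - g i))
              (by linarith)
            rw [← Fin.sum_univ_eq_sum_range
              (fun j => if (2 : ℝ) ^ j < 2 * (g ((i : ℕ) + (2 * b + 1)) - g i) then (2 : ℝ) ^ j
                else 0)] at h1
            simp only [hgs]
            refine h1.trans (le_of_eq ?_)
            ring
        _ ≤ _ := by
            rw [← Finset.mul_sum, Fin.sum_univ_eq_sum_range (fun i => g (i + (2 * b + 1)) - g i)]
            have := sum_shift_sub_le g (2 ^ J) hg0 hgB N (2 * b + 1)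
            push_cast at this
            linarith
    rw [hΨ]
    refine (Finset.sum_le_sum fun k _ => hup k x y).trans ?_
    rw [← Finset.mul_sum, Finset.sum_add_distrib]
    have h1 := add_le_add (hside x) (hside y)
    have h2 := mul_le_mul_of_nonneg_left h1 (by positivity : 0 ≤ 36 * dist x y ^ 2)
    refine h2.trans (le_of_eq ?_)
    ring
  · rcases eq_or_ne x y with rfl | hxy
    · simp
    obtain ⟨i, hi, hd1, hd2⟩ := hN x y hxy
    set t := τ * 2 ^ i with ht
    have htp : 0 < t := by positivity
    let Q : ℕ → Prop := fun j =>
      ballCount x (2 ^ b * t) ≤ 2 ^ 2 ^ j * ballCount x (2 * (γ j * t)) ∧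
        ballCount y (2 ^ b * t) ≤ 2 ^ 2 ^ j * ballCount y (2 * (γ j * t))
    have hQJ : Q J := by
      have h1 : ∀ u : X, ballCount u (2 ^ b * t) ≤ 2 ^ 2 ^ J * ballCount u (2 * (γ J * t)) :=
        fun u => by
          have h2 := ballCount_pos u (r := 2 * (γ J * t)) (by have := hγ J; positivity)
          exact ((ballCount_le_card u _).trans hcard).trans (Nat.le_mul_of_pos_right _ h2)
      exact ⟨h1 x, h1 y⟩
    have hexQ : ∃ j, Q j := ⟨J, hQJ⟩
    set j := Nat.find hexQ with hj
    have hQj : Q j := Nat.find_spec hexQ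
    have hjJ : j ≤ J := Nat.find_min' hexQ hQJ
    have hP : (2 ^ 2 ^ j * ballCount x (2 * (γ j * t)) ^ 2 < ballCount x (2 ^ b * t) ^ 2) ∨
        2 ^ 2 ^ j * ballCount y (2 * (γ j * t)) ^ 2 < ballCount y (2 ^ b * t) ^ 2 := by
      rcases Nat.eq_zero_or_pos j with h0 | hpos
      · rw [h0]
        have hbt : 4 * t ≤ 2 ^ b * t := by
          have : (2 : ℝ) ^ 2 ≤ 2 ^ b := pow_le_pow_right₀ one_le_two hb2
          nlinarith
        have hγt : 2 * (γ 0 * t) ≤ t / 8 := by nlinarith [hγ1 0]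
        have hdisj : ∀ u v : X, dist u v ≤ 2 * t → t ≤ dist u v →
            ballCount u (2 * (γ 0 * t)) + ballCount v (2 * (γ 0 * t)) ≤
              ballCount u (2 ^ b * t) := by
          intro u v h1 h2
          unfold ballCount
          rw [← Finset.card_union_of_disjoint]
          · refine Finset.card_le_card fun w hw => ?_
            simp only [Finset.mem_union, Finset.mem_filter, Finset.mem_univ, true_and] at hw ⊢
            rcases hw with hw | hw
            · linarith
            · linarith [dist_triangle u v w]
          · rw [Finset.disjoint_left]
            intro w hw hw'
            simp only [Finset.mem_filter, Finset.mem_univ, true_and] at hw hw'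
            linarith [dist_triangle_right u v w]
        have h1 := hdisj x y hd2 hd1
        have h2 := hdisj y x (by rwa [dist_comm]) (by rwa [dist_comm])
        have hp1 := ballCount_pos x (r := 2 * (γ 0 * t)) (by have := hγ 0; positivity)
        have hp2 := ballCount_pos y (r := 2 * (γ 0 * t)) (by have := hγ 0; positivity)
        rcases le_total (ballCount x (2 * (γ 0 * t))) (ballCount y (2 * (γ 0 * t))) with h | h
        · left; norm_num; nlinarith
        · right; norm_num; nlinarith
      · have hnot : ¬ Q (j - 1) := Nat.find_min hexQ (by omega)
        have hpow : 2 ^ 2 ^ j = (2 ^ 2 ^ (j - 1)) ^ 2 := by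
          rw [← pow_mul, ← pow_succ, Nat.sub_add_cancel hpos]
        have hstep : ∀ u : X,
            2 ^ 2 ^ (j - 1) * ballCount u (2 * (γ (j - 1) * t)) < ballCount u (2 ^ b * t) →
            2 ^ 2 ^ j * ballCount u (2 * (γ j * t)) ^ 2 < ballCount u (2 ^ b * t) ^ 2 := by
          intro u hu
          have h1 : ballCount u (2 * (γ j * t)) ≤ ballCount u (2 * (γ (j - 1) * t)) := by
            refine ballCount_le_ballCount u u ?_
            rw [dist_self, zero_add]
            have := hγa (Nat.sub_le j 1)
            gcongr
          rw [hpow, ← mul_pow]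
          refine Nat.pow_lt_pow_left (lt_of_le_of_lt ?_ hu) two_ne_zero
          gcongr
        simp only [Q, not_and_or, not_le] at hnot
        exact hnot.imp (hstep x) (hstep y)
    let k : Fin N × Fin (J + 1) := (⟨i, hi⟩, ⟨j, by omega⟩)
    have hlow' : 2 ^ j * γ j ^ 2 * η * dist x y ^ 2 / 4 ≤ ‖Ψ' k x - Ψ' k y‖ ^ 2 := by
      rcases hP with hP | hP
      · rw [norm_sub_rev, dist_comm]
        exact hlow k y x hQj.2 hQj.1 (by rw [dist_comm]; exact hd1) (by rw [dist_comm]; exact hd2)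
          hP
      · exact hlow k x y hQj.1 hQj.2 hd1 hd2 hP
    rw [hΨ]
    refine le_trans ?_ (hlow'.trans (Finset.single_le_sum
      (f := fun k => ‖Ψ' k x - Ψ' k y‖ ^ 2) (fun _ _ => sq_nonneg _) (Finset.mem_univ k)))
    have := mul_le_mul_of_nonneg_right (hδ j hjJ)
      (by positivity : 0 ≤ η * dist x y ^ 2 / 4)
    linarith

lemma embedsWithDistortion_of_sq_bounds {X : Type*} [PseudoMetricSpace X] (Ψ : X → SeqL2)
    {l u K : ℝ} (hu : 0 < u) (hK : 0 < K) (hlu : u ≤ l * K ^ 2)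
    (hup : ∀ x y, ‖Ψ x - Ψ y‖ ^ 2 ≤ u * dist x y ^ 2)
    (hlow : ∀ x y, l * dist x y ^ 2 ≤ ‖Ψ x - Ψ y‖ ^ 2) : EmbedsWithDistortion X SeqL2 K := by
  refine ⟨√u, Real.sqrt_pos.2 hu, Ψ, fun x y => ?_⟩
  rw [dist_eq_norm]
  constructor
  · refine le_of_sq_le_sq ?_ (norm_nonneg _)
    refine le_trans ?_ (hlow x y)
    rw [mul_pow, div_pow, Real.sq_sqrt hu.le]
    refine mul_le_mul_of_nonneg_right ?_ (sq_nonneg _)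
    exact (div_le_iff₀ (by positivity)).2 hlu
  · refine le_of_sq_le_sq ?_ (by positivity)
    rw [mul_pow, Real.sq_sqrt hu.le]
    exact hup x y

lemma exists_map_of_hasLocalMaps {X E : Type*} [Fintype X] [MetricSpace X]
    [NormedAddCommGroup E] {a θ c κ D : ℝ} (hE : HasLocalMaps E a θ c) (ha : 0 ≤ a) (hc : 0 < c)
    (hθ : 1 / 2 ≤ θ) (e : X → E) (he : ∀ x y, ‖e x - e y‖ = dist x y) (hκ0 : 0 < κ)
    (hκ1 : κ ≤ 1 / 16) (hκc : 9 * κ ≤ c * (1 / 2) ^ (1 + a)) (hD0 : 0 ≤ D)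
    (hD : Fintype.card X * Real.exp (-(2 * D)) ≤ 1 / 2) {J b : ℕ}
    (hcard : Fintype.card X ≤ 2 ^ 2 ^ J) (hb : (D + 3) ^ a * (2 ^ J : ℝ) ^ θ / κ ≤ 2 ^ b)
    (hb' : 2 * (D + 3) + 1 ≤ 2 ^ b) :
    ∃ Ψ : X → SeqL2,
      (∀ x y, ‖Ψ x - Ψ y‖ ^ 2 ≤ 288 * (2 * b + 1) * 2 ^ J * dist x y ^ 2) ∧
      ∀ x y, 2 ^ J * (κ / ((D + 3) ^ a * (2 ^ J : ℝ) ^ θ)) ^ 2 * (sphereGap / 4) / 4 *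
        dist x y ^ 2 ≤ ‖Ψ x - Ψ y‖ ^ 2 := by
  have hDa : 1 ≤ (D + 3) ^ a := Real.one_le_rpow (by linarith) ha
  have hpow : ∀ j : ℕ, (1 : ℝ) ≤ (2 ^ j : ℝ) ^ θ := fun j =>
    Real.one_le_rpow (one_le_pow₀ one_le_two) (by linarith)
  have hmono : ∀ {i j : ℕ}, i ≤ j → (2 ^ i : ℝ) ^ θ ≤ (2 ^ j : ℝ) ^ θ := fun h =>
    Real.rpow_le_rpow (by positivity) (pow_le_pow_right₀ one_le_two h) (by linarith)
  have hden : ∀ j : ℕ, 1 ≤ (D + 3) ^ a * (2 ^ j : ℝ) ^ θ := fun j =>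
    one_le_mul_of_one_le_of_one_le hDa (hpow j)
  set γ : ℕ → ℝ := fun j => κ / ((D + 3) ^ a * (2 ^ j : ℝ) ^ θ) with hγ
  have hγ0 : ∀ j, 0 < γ j := fun j => div_pos hκ0 (by linarith [hden j])
  have hγ1 : ∀ j, γ j ≤ 1 / 16 := fun j => (div_le_self hκ0.le (hden j)).trans hκ1
  have hγa : Antitone γ := fun i j hij => by
    have h1 := hden i
    have h2 := hmono hij
    simp only [hγ]
    gcongr
  refine exists_glued_map hcard hγ0 hγ1 hγa ?_ (fun j hj => ?_)
    (by linarith [sphereGap_pos]) (by linarith [sphereGap_le_one, sphereGap_pos])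
    (fun j hj => ?_) fun τ hτ j hj => ?_
  · by_contra hcon
    have h1 : (2 : ℝ) ^ b ≤ 2 ^ 1 := pow_le_pow_right₀ one_le_two (by omega)
    linarith
  · refine le_trans ?_ (hγa hj)
    have h1 := hden J
    rw [one_div_pow, one_div_le (by positivity) (hγ0 J)]
    refine le_trans (le_of_eq ?_) hb
    simp only [hγ]
    rw [one_div_div]
  · have hform : ∀ j : ℕ, (2 : ℝ) ^ j * γ j ^ 2 =
        (κ / (D + 3) ^ a) ^ 2 * (2 ^ j : ℝ) ^ (1 - 2 * θ) := by
      intro j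
      have h2 : (0 : ℝ) < 2 ^ j := by positivity
      rw [Real.rpow_sub h2, Real.rpow_one, mul_comm 2 θ, Real.rpow_mul h2.le]
      simp only [hγ]
      have := hpow j
      norm_cast
      field_simp
    rw [hform, hform]
    refine mul_le_mul_of_nonneg_left ?_ (sq_nonneg _)
    exact Real.rpow_le_rpow_of_nonpos (by positivity) (pow_le_pow_right₀ one_le_two hj)
      (by linarith)
  · obtain ⟨Φ, h1, h2, h3⟩ := exists_single_scale_map hE ha hc e he (m := 2 ^ j) (A := 2 ^ b)
      Nat.one_le_two_pow hD0 hτ (hγ0 j) (hγ1 j) hD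
      (by
        have := hden j
        push_cast
        simp only [hγ]
        rw [mul_div_assoc']
        gcongr)
      hb' {u | ballCount u (2 ^ b * τ) ≤ 2 ^ 2 ^ j * ballCount u (2 * (γ j * τ))}
      fun u hu => hu
    exact ⟨Φ, h1, h2, fun x y hx hy => h3 x hx y hy⟩

lemma exists_pow_two_near_log {n : ℕ} (hn : 2 ≤ n) :
    ∃ J : ℕ, n ≤ 2 ^ 2 ^ J ∧ (2 : ℝ) ^ J ≤ 7 * Real.log n := by
  have hn' : (2 : ℝ) ≤ n := by exact_mod_cast hn
  have hlog : Real.log 2 ≤ Real.log n := Real.log_le_log two_pos hn'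
  have hlog2 := Real.log_two_gt_d9
  set K := Nat.clog 2 n with hK
  have hK1 : 1 ≤ K := Nat.clog_pos one_lt_two hn
  have hKn : n ≤ 2 ^ K := Nat.le_pow_clog one_lt_two n
  have hKlog : (K : ℝ) ≤ 3 * Real.log n := by
    have h1 : 2 ^ (K - 1) < n := Nat.pow_pred_clog_lt_self one_lt_two hn
    have h2 : ((2 : ℝ)) ^ (K - 1) ≤ n := by exact_mod_cast h1.le
    have h3 := Real.log_le_log (by positivity) h2
    rw [Real.log_pow, Nat.cast_sub hK1, Nat.cast_one] at h3
    nlinarith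
  obtain hK2 | hK2 := Nat.eq_or_lt_of_le hK1
  · refine ⟨0, ?_, ?_⟩
    · rw [pow_zero]; rw [← hK2] at hKn; exact hKn
    · rw [pow_zero]; linarith
  · refine ⟨Nat.clog 2 K, ?_, ?_⟩
    · exact hKn.trans (Nat.pow_le_pow_right two_pos (Nat.le_pow_clog one_lt_two K))
    · have h1 : 2 ^ (Nat.clog 2 K - 1) < K := Nat.pow_pred_clog_lt_self one_lt_two hK2
      have h2 : 1 ≤ Nat.clog 2 K := Nat.clog_pos one_lt_two hK2
      have h3 : 2 ^ Nat.clog 2 K = 2 * 2 ^ (Nat.clog 2 K - 1) := by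
        rw [← pow_succ', Nat.sub_add_cancel h2]
      have h4 : 2 ^ Nat.clog 2 K ≤ 2 * K := by omega
      have h5 : (2 : ℝ) ^ Nat.clog 2 K ≤ 2 * K := by exact_mod_cast h4
      linarith

lemma exists_embedding_of_hasLocalMaps {E : Type*} [NormedAddCommGroup E] {a θ c ε : ℝ}
    (hE : HasLocalMaps E a θ c) (ha : 0 ≤ a) (hc : 0 < c) (hθ : 1 / 2 ≤ θ) (hε : 0 < ε) :
    ∃ C : ℝ, 0 < C ∧ ∀ n : ℕ, 2 ≤ n → ∀ X : Set E, X.Finite → X.ncard ≤ n →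
      EmbedsWithDistortion X SeqL2 (C * Real.log n ^ (θ + a + ε)) := by
  set κ := min (1 / 16) (c * (1 / 2) ^ (1 + a) / 9) with hκ
  have hκ0 : 0 < κ := lt_min (by norm_num) (by positivity)
  have hκ1 : κ ≤ 1 / 16 := min_le_left _ _
  have hκc : 9 * κ ≤ c * (1 / 2) ^ (1 + a) := by
    have : κ ≤ c * (1 / 2) ^ (1 + a) / 9 := min_le_right _ _
    linarith
  have hη := sphereGap_pos
  set s := 2 * ε / (a + θ + 1) with hs
  have hs0 : 0 < s := by positivity
  set B := 5 + 4 * ((1 / κ + 3) ^ s / s) with hB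
  have hB0 : 0 < B := by positivity
  set M := 288 * B * 16 / (κ ^ 2 * sphereGap) with hM
  have hM0 : 0 < M := by positivity
  refine ⟨√M * 7 ^ (θ + a + ε), by positivity, fun n hn X hX hXn => ?_⟩
  have := hX.fintype
  have hcard : Fintype.card X ≤ n := by rwa [← Nat.card_eq_fintype_card]
  have hn' : (2 : ℝ) ≤ n := by exact_mod_cast hn
  have hlog : Real.log 2 ≤ Real.log n := Real.log_le_log two_pos hn'
  have hlog2 := Real.log_two_gt_d9
  obtain ⟨J, hJ1, hJ2⟩ := exists_pow_two_near_log hn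
  set t := 7 * Real.log n with ht
  have ht1 : 1 ≤ t := by linarith
  have ht0 : 0 < t := by linarith
  set D := Real.log n + 1 with hD
  have hD3 : D + 3 ≤ t := by linarith
  have hD0 : 0 ≤ D := by linarith
  have hDe : Fintype.card X * Real.exp (-(2 * D)) ≤ 1 / 2 := by
    have h1 : Real.exp (-(2 * D)) ≤ Real.exp (-Real.log n - 1) := Real.exp_le_exp.2 (by linarith)
    have h2 : Real.exp (-Real.log n - 1) = (n : ℝ)⁻¹ * Real.exp (-1) := by
      rw [sub_eq_add_neg, Real.exp_add, Real.exp_neg, Real.exp_log (by linarith)]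
    have h3 : Real.exp (-1) ≤ 1 / 2 := by
      rw [Real.exp_neg, inv_eq_one_div]
      exact one_div_le_one_div_of_le two_pos (by linarith [Real.exp_one_gt_d9])
    calc (Fintype.card X : ℝ) * Real.exp (-(2 * D)) ≤ n * ((n : ℝ)⁻¹ * (1 / 2)) := by
          have h4 : (Fintype.card X : ℝ) ≤ n := by exact_mod_cast hcard
          rw [h2] at h1
          have h5 : (n : ℝ)⁻¹ * Real.exp (-1) ≤ (n : ℝ)⁻¹ * (1 / 2) := by gcongr
          exact mul_le_mul h4 (h1.trans h5) (Real.exp_pos _).le (by linarith)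
      _ = 1 / 2 := by field_simp
  have hden : (D + 3) ^ a * (2 ^ J : ℝ) ^ θ ≤ t ^ (a + θ) := by
    rw [Real.rpow_add ht0]
    gcongr
  set W := (D + 3) ^ a * (2 ^ J : ℝ) ^ θ / κ + (2 * (D + 3) + 1) with hW
  have hq0 : 0 < (D + 3) ^ a * (2 ^ J : ℝ) ^ θ / κ := by positivity
  have hW1 : 1 ≤ W := by linarith
  have hWt : W ≤ (1 / κ + 3) * t ^ (a + θ + 1) := by
    have h1 : t ^ (a + θ) ≤ t ^ (a + θ + 1) := Real.rpow_le_rpow_of_exponent_le ht1 (by linarith)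
    have h2 : t ≤ t ^ (a + θ + 1) := by
      conv_lhs => rw [← Real.rpow_one t]
      exact Real.rpow_le_rpow_of_exponent_le ht1 (by linarith)
    have h3 : (D + 3) ^ a * (2 ^ J : ℝ) ^ θ / κ ≤ t ^ (a + θ + 1) / κ := by
      gcongr
      exact hden.trans h1
    calc W ≤ t ^ (a + θ + 1) / κ + 3 * t ^ (a + θ + 1) := by linarith
      _ = _ := by ring
  obtain ⟨k, hk1, hk2⟩ := exists_nat_pow_near hW1 (one_lt_two (α := ℝ))
  obtain ⟨Ψ, hup, hlow⟩ := exists_map_of_hasLocalMaps hE ha hc hθ (fun x : X => (x : E))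
    (fun x y => by rw [Subtype.dist_eq, dist_eq_norm]) hκ0 hκ1 hκc hD0 hDe (hcard.trans hJ1)
    (b := k + 1) (by linarith) (by linarith)
  have hbB : 2 * ((k + 1 : ℕ) : ℝ) + 1 ≤ B * t ^ (2 * ε) := by
    have h1 := Real.log_le_log (by positivity) hk1
    rw [Real.log_pow] at h1
    have h2 : Real.log W ≤ W ^ s / s := Real.log_le_rpow_div (by linarith) hs0
    have h3 : W ^ s ≤ (1 / κ + 3) ^ s * t ^ (2 * ε) := by
      refine (Real.rpow_le_rpow (by linarith) hWt hs0.le).trans (le_of_eq ?_)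
      rw [Real.mul_rpow (by positivity) (by positivity), ← Real.rpow_mul ht0.le]
      congr 2
      rw [hs]; field_simp
    have h4 : W ^ s / s ≤ (1 / κ + 3) ^ s / s * t ^ (2 * ε) := by
      rw [div_mul_eq_mul_div]
      gcongr
    have h5 : 1 ≤ t ^ (2 * ε) := Real.one_le_rpow ht1 (by linarith)
    have h6 : (k : ℝ) * (1 / 2) ≤ k * Real.log 2 := by gcongr; linarith
    push_cast
    rw [hB]
    nlinarith
  refine embedsWithDistortion_of_sq_bounds Ψ (by positivity) ?_ ?_ hup hlow
  · have : 0 < Real.log n := by linarith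
    positivity
  · have hK2 : (√M * 7 ^ (θ + a + ε) * Real.log n ^ (θ + a + ε)) ^ 2 =
        M * (t ^ (a + θ)) ^ 2 * t ^ (2 * ε) := by
      rw [mul_assoc, ← Real.mul_rpow (by norm_num) (by linarith), ← ht, mul_pow,
        Real.sq_sqrt hM0.le, show θ + a + ε = (a + θ) + ε by ring, Real.rpow_add ht0, mul_pow,
        mul_comm 2 ε, Real.rpow_mul ht0.le, mul_assoc]
      norm_cast
    rw [hK2]
    have hden0 : 0 < (D + 3) ^ a * (2 ^ J : ℝ) ^ θ := by positivity
    have h7 : 1 ≤ (t ^ (a + θ)) ^ 2 / ((D + 3) ^ a * (2 ^ J : ℝ) ^ θ) ^ 2 := by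
      rw [one_le_div (by positivity)]
      gcongr
    calc 288 * (2 * ((k + 1 : ℕ) : ℝ) + 1) * 2 ^ J
        ≤ 288 * (B * t ^ (2 * ε)) * 2 ^ J * 1 := by rw [mul_one]; gcongr
      _ ≤ 288 * (B * t ^ (2 * ε)) * 2 ^ J *
          ((t ^ (a + θ)) ^ 2 / ((D + 3) ^ a * (2 ^ J : ℝ) ^ θ) ^ 2) := by gcongr
      _ = _ := by
          rw [hM, div_pow]
          field_simp
          norm_num

/-- The graph of `x ↦ x ^ r` lies above its tangents. -/
lemma rpow_tangent_le {a b r : ℝ} (ha : 0 ≤ a) (hb : 0 ≤ b) (hr : 1 ≤ r) :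
    a ^ r + r * a ^ (r - 1) * (b - a) ≤ b ^ r := by
  rcases ha.eq_or_lt with rfl | ha
  · rw [Real.zero_rpow (by linarith), zero_add, sub_zero]
    rcases hr.eq_or_lt with rfl | hr
    · simp
    · rw [Real.zero_rpow (by linarith)]
      simp only [mul_zero, zero_mul]
      positivity
  · have h1 := one_add_mul_self_le_rpow_one_add (s := b / a - 1)
      (by have : 0 ≤ b / a := by positivity
          linarith) hr
    rw [add_sub_cancel, Real.div_rpow hb ha.le, le_div_iff₀ (by positivity)] at h1
    refine le_trans (le_of_eq ?_) h1
    rw [Real.rpow_sub_one ha.ne']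
    field_simp

lemma two_point_smooth_aux {p x : ℝ} (hp : 2 ≤ p) (hx0 : 0 ≤ x) :
    |1 + x| ^ p + |1 - x| ^ p ≤ 2 * (1 + (4 + 2 * p * 2 ^ p) * x ^ 2) ^ (p / 2) := by
  have h2p : (0 : ℝ) < 2 ^ p := by positivity
  have hsq : ∀ y : ℝ, 0 ≤ y → y ^ p = (y ^ 2) ^ (p / 2) := fun y hy => by
    rw [← Real.rpow_natCast, ← Real.rpow_mul hy]
    congr 1
    push_cast; ring
  rcases le_total 1 x with hx | hx
  · have key : ∀ y : ℝ, |y| ≤ 2 * x → |y| ^ p ≤ (1 + (4 + 2 * p * 2 ^ p) * x ^ 2) ^ (p / 2) := by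
      intro y hy
      rw [hsq _ (abs_nonneg y)]
      refine Real.rpow_le_rpow (by positivity) ?_ (by linarith)
      have h1 := pow_le_pow_left₀ (abs_nonneg y) hy 2
      have h2 : 0 ≤ 2 * p * 2 ^ p * x ^ 2 := by positivity
      nlinarith
    have h1 := key (1 + x) (abs_le.2 ⟨by linarith, by linarith⟩)
    have h2 := key (1 - x) (abs_le.2 ⟨by linarith, by linarith⟩)
    linarith
  · rw [abs_of_nonneg (by linarith), abs_of_nonneg (by linarith)]
    have h1 := rpow_tangent_le (a := 1 + x) (b := 1) (r := p) (by linarith) zero_le_one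
      (by linarith)
    have h2 := rpow_tangent_le (a := 1 - x) (b := 1) (r := p) (by linarith) zero_le_one
      (by linarith)
    have h3 := rpow_tangent_le (a := 1 + x) (b := 1 - x) (r := p - 1) (by linarith) (by linarith)
      (by linarith)
    have h4 := one_add_mul_self_le_rpow_one_add (s := (4 + 2 * p * 2 ^ p) * x ^ 2) (p := p / 2)
      (by have : 0 ≤ (4 + 2 * p * 2 ^ p) * x ^ 2 := by positivity
          linarith) (by linarith)
    have h5 : (1 + x) ^ (p - 1 - 1) ≤ 2 ^ p :=
      (Real.rpow_le_rpow (by linarith) (by linarith) (by linarith)).trans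
        (Real.rpow_le_rpow_of_exponent_le one_le_two (by linarith))
    rw [Real.one_rpow] at h1 h2
    have h6 : p * x * ((1 + x) ^ (p - 1) - (1 - x) ^ (p - 1)) ≤
        p * x * ((p - 1) * 2 ^ p * (2 * x)) := by
      refine mul_le_mul_of_nonneg_left ?_ (by positivity)
      have h7 : (p - 1) * (1 + x) ^ (p - 1 - 1) * (2 * x) ≤ (p - 1) * 2 ^ p * (2 * x) := by
        have : 0 ≤ p - 1 := by linarith
        gcongr
      linarith
    have h8 : 0 ≤ p * x ^ 2 * 2 ^ p := by positivity
    have h9 : 0 ≤ p * x ^ 2 := by positivity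
    nlinarith

/-- Two-point smoothness inequality for real numbers. -/
lemma two_point_smooth {p : ℝ} (hp : 2 ≤ p) (s t : ℝ) :
    |s + t| ^ p + |s - t| ^ p ≤ 2 * (|s| ^ 2 + (4 + 2 * p * 2 ^ p) * |t| ^ 2) ^ (p / 2) := by
  have hsq : ∀ y : ℝ, 0 ≤ y → y ^ p = (y ^ 2) ^ (p / 2) := fun y hy => by
    rw [← Real.rpow_natCast, ← Real.rpow_mul hy]
    congr 1
    push_cast; ring
  have hC : 1 ≤ 4 + 2 * p * 2 ^ p := by
    have : 0 ≤ 2 * p * 2 ^ p := by positivity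
    linarith
  rcases eq_or_ne s 0 with rfl | hs
  · rw [zero_add, zero_sub, abs_neg, abs_zero, hsq _ (abs_nonneg t)]
    have : (|t| ^ 2) ^ (p / 2) ≤ (0 ^ 2 + (4 + 2 * p * 2 ^ p) * |t| ^ 2) ^ (p / 2) := by
      refine Real.rpow_le_rpow (by positivity) ?_ (by linarith)
      nlinarith [sq_nonneg |t|]
    linarith
  · have hs0 : 0 < |s| := abs_pos.2 hs
    have hx : |1 + t / s| ^ p + |1 - t / s| ^ p ≤
        2 * (1 + (4 + 2 * p * 2 ^ p) * (t / s) ^ 2) ^ (p / 2) := by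
      rcases le_total 0 (t / s) with h | h
      · exact two_point_smooth_aux hp h
      · have := two_point_smooth_aux hp (neg_nonneg.2 h)
        rwa [neg_sq, sub_neg_eq_add, ← sub_eq_add_neg, add_comm (|1 - t / s| ^ p)] at this
    have e1 : s + t = s * (1 + t / s) := by field_simp
    have e2 : s - t = s * (1 - t / s) := by field_simp
    have h2 := mul_le_mul_of_nonneg_left hx (by positivity : 0 ≤ |s| ^ p)
    rw [e1, e2, abs_mul, abs_mul, Real.mul_rpow (abs_nonneg _) (abs_nonneg _),
      Real.mul_rpow (abs_nonneg _) (abs_nonneg _), ← mul_add]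
    refine h2.trans (le_of_eq ?_)
    rw [hsq _ (abs_nonneg s), mul_left_comm, ← Real.mul_rpow (by positivity) (by positivity),
      sq_abs, sq_abs]
    congr 2
    field_simp

/-- The space of `r`-summable sequences. -/
abbrev SeqLp (r : ℝ) : Type := lp (fun _ : ℕ => ℝ) (ENNReal.ofReal r)

lemma seqLp_summable {r : ℝ} (hr : 0 < r) (f : SeqLp r) : Summable fun i => |f i| ^ r := by
  have h := (lp.memℓp f).summable (by rwa [ENNReal.toReal_ofReal hr.le])
  simpa [ENNReal.toReal_ofReal hr.le] using h

lemma seqLp_norm_rpow {r : ℝ} (hr : 0 < r) (f : SeqLp r) : ‖f‖ ^ r = ∑' i, |f i| ^ r := by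
  have h := lp.norm_rpow_eq_tsum (p := ENNReal.ofReal r) (by rwa [ENNReal.toReal_ofReal hr.le]) f
  simpa [ENNReal.toReal_ofReal hr.le] using h

/-- The norm of `ℓ_p`, for `p ≥ 2`, is uniformly smooth of power type `2`. -/
lemma seqLp_smooth {p : ℝ} (hp : 2 ≤ p) [Fact (1 ≤ ENNReal.ofReal p)] (f g : SeqLp p) :
    ‖f + g‖ ^ 2 + ‖f - g‖ ^ 2 ≤ 2 * ‖f‖ ^ 2 + 2 * (4 + 2 * p * 2 ^ p) * ‖g‖ ^ 2 := by
  have hp0 : 0 < p := by linarith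
  have hr : 1 ≤ p / 2 := by linarith
  have hsq : ∀ y : ℝ, 0 ≤ y → (y ^ 2) ^ (p / 2) = y ^ p := fun y hy => by
    rw [← Real.rpow_natCast, ← Real.rpow_mul hy]
    congr 1
    push_cast; ring
  set S := 4 + 2 * p * 2 ^ p with hS
  have hS0 : 0 < S := by positivity
  have hgsum : ∀ i, (S * |g i| ^ 2) ^ (p / 2) = S ^ (p / 2) * |g i| ^ p := fun i => by
    rw [Real.mul_rpow hS0.le (sq_nonneg _), hsq _ (abs_nonneg _)]
  obtain ⟨hs, hle⟩ := Real.Lp_add_le_tsum_of_nonneg hr (f := fun i => |f i| ^ 2)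
    (g := fun i => S * |g i| ^ 2) (fun i => sq_nonneg _) (fun i => by positivity)
    (by simpa only [hsq _ (abs_nonneg _)] using seqLp_summable hp0 f)
    (by simpa only [hgsum] using (seqLp_summable hp0 g).mul_left _)
  simp only [hsq _ (abs_nonneg _), hgsum] at hle
  rw [tsum_mul_left, ← seqLp_norm_rpow hp0, ← seqLp_norm_rpow hp0, ← hsq _ (norm_nonneg _),
    ← hsq _ (norm_nonneg _), ← Real.mul_rpow hS0.le (sq_nonneg _), one_div,
    Real.rpow_rpow_inv (sq_nonneg _) (by linarith),
    Real.rpow_rpow_inv (by positivity) (by linarith)] at hle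
  have hsum : (‖f + g‖ ^ 2) ^ (p / 2) + (‖f - g‖ ^ 2) ^ (p / 2) ≤
      2 * ∑' i, (|f i| ^ 2 + S * |g i| ^ 2) ^ (p / 2) := by
    rw [hsq _ (norm_nonneg _), hsq _ (norm_nonneg _), seqLp_norm_rpow hp0, seqLp_norm_rpow hp0,
      ← (seqLp_summable hp0 (f + g)).tsum_add (seqLp_summable hp0 (f - g)), ← tsum_mul_left]
    refine ((seqLp_summable hp0 (f + g)).add (seqLp_summable hp0 (f - g))).tsum_le_tsum
      (fun i => ?_) (hs.mul_left 2)
    exact two_point_smooth hp (f i) (g i)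
  set μ := (‖f + g‖ ^ 2 + ‖f - g‖ ^ 2) / 2 with hμ
  have hμ0 : 0 ≤ μ := by positivity
  have h1 := rpow_tangent_le hμ0 (sq_nonneg ‖f + g‖) hr
  have h2 := rpow_tangent_le hμ0 (sq_nonneg ‖f - g‖) hr
  have h3 : p / 2 * μ ^ (p / 2 - 1) * (‖f + g‖ ^ 2 - μ) +
      p / 2 * μ ^ (p / 2 - 1) * (‖f - g‖ ^ 2 - μ) = 0 := by
    rw [← mul_add, hμ]; ring
  have h4 : μ ^ (p / 2) ≤ ∑' i, (|f i| ^ 2 + S * |g i| ^ 2) ^ (p / 2) := by linarith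
  have h5 := Real.rpow_le_rpow (by positivity) h4 (by positivity : 0 ≤ (p / 2)⁻¹)
  rw [Real.rpow_rpow_inv hμ0 (by linarith)] at h5
  have h6 := h5.trans hle
  linarith

/-- The signed power `x |x| ^ a`. -/
def signedPow (a x : ℝ) : ℝ := x * |x| ^ a

lemma abs_signedPow {a : ℝ} (ha : 0 < a) (x : ℝ) : |signedPow a x| = |x| ^ (1 + a) := by
  rw [signedPow, abs_mul, abs_of_nonneg (by positivity : 0 ≤ |x| ^ a)]
  rcases (abs_nonneg x).eq_or_lt with h | h
  · rw [← h, zero_mul, Real.zero_rpow (by linarith)]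
  · rw [Real.rpow_add h, Real.rpow_one]

lemma signedPow_neg (a x : ℝ) : signedPow a (-x) = -signedPow a x := by
  simp [signedPow]

lemma signedPow_bounds {a : ℝ} (ha : 0 < a) (x y : ℝ) :
    |signedPow a x - signedPow a y| ≤ (1 + a) * ((|x| + |y|) ^ a * |x - y|) ∧
      (1 / 2) ^ (1 + a) * |x - y| ^ (1 + a) ≤ |signedPow a x - signedPow a y| := by
  have hnn : ∀ x, 0 ≤ x → signedPow a x = x ^ (1 + a) := fun x hx => by
    have h := abs_signedPow ha x
    have h0 : 0 ≤ signedPow a x := mul_nonneg hx (Real.rpow_nonneg (abs_nonneg x) a)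
    rwa [abs_of_nonneg h0, abs_of_nonneg hx] at h
  have hhalf : (1 / 2 : ℝ) ^ (1 + a) ≤ 1 := Real.rpow_le_one (by norm_num) (by norm_num)
    (by linarith)
  have hpos : ∀ x y : ℝ, 0 ≤ y → y ≤ x →
      |signedPow a x - signedPow a y| ≤ (1 + a) * ((|x| + |y|) ^ a * |x - y|) ∧
      (1 / 2) ^ (1 + a) * |x - y| ^ (1 + a) ≤ |signedPow a x - signedPow a y| := by
    intro x y hy hxy
    have hx : 0 ≤ x := hy.trans hxy
    have hd : 0 ≤ x - y := by linarith
    have h1 := rpow_tangent_le hx hy (r := 1 + a) (by linarith)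
    have h2 := Real.add_rpow_le_rpow_add hd hy (p := 1 + a) (by linarith)
    rw [sub_add_cancel] at h2
    rw [add_sub_cancel_left] at h1
    have h3 : 0 ≤ (x - y) ^ (1 + a) := by positivity
    rw [hnn x hx, hnn y hy, abs_of_nonneg hd, abs_of_nonneg hx, abs_of_nonneg hy,
      abs_of_nonneg (by linarith)]
    constructor
    · have h4 : x ^ a * (x - y) ≤ (x + y) ^ a * (x - y) := by gcongr; linarith
      have h5 := mul_le_mul_of_nonneg_left h4 (by linarith : 0 ≤ 1 + a)
      nlinarith
    · nlinarith
  have hopp : ∀ x y : ℝ, 0 ≤ y → 0 ≤ x →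
      |signedPow a x - signedPow a (-y)| ≤ (1 + a) * ((|x| + |(-y)|) ^ a * |x - -y|) ∧
      (1 / 2) ^ (1 + a) * |x - -y| ^ (1 + a) ≤ |signedPow a x - signedPow a (-y)| := by
    intro x y hy hx
    rw [signedPow_neg, sub_neg_eq_add, sub_neg_eq_add, abs_neg, hnn x hx, hnn y hy,
      abs_of_nonneg hx, abs_of_nonneg hy, abs_of_nonneg (by positivity),
      abs_of_nonneg (by positivity)]
    have h2 := Real.add_rpow_le_rpow_add hx hy (p := 1 + a) (by linarith)
    have h3 : (x + y) ^ a * (x + y) = (x + y) ^ (1 + a) := by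
      have := abs_signedPow ha (x + y)
      rw [signedPow, abs_mul, abs_of_nonneg (by positivity : 0 ≤ x + y),
        abs_of_nonneg (by positivity)] at this
      linarith
    rw [h3, ← Real.mul_rpow (by norm_num) (by positivity)]
    have h4 : 0 ≤ (x + y) ^ (1 + a) := by positivity
    have h5 : 0 ≤ x ^ (1 + a) := by positivity
    have h6 : 0 ≤ y ^ (1 + a) := by positivity
    refine ⟨by nlinarith, ?_⟩
    rcases le_total x y with h | h
    · have : (1 / 2 * (x + y)) ^ (1 + a) ≤ y ^ (1 + a) := by gcongr; linarith
      linarith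
    · have : (1 / 2 * (x + y)) ^ (1 + a) ≤ x ^ (1 + a) := by gcongr; linarith
      linarith
  have hall : ∀ x y : ℝ, y ≤ x →
      |signedPow a x - signedPow a y| ≤ (1 + a) * ((|x| + |y|) ^ a * |x - y|) ∧
      (1 / 2) ^ (1 + a) * |x - y| ^ (1 + a) ≤ |signedPow a x - signedPow a y| := by
    intro x y hxy
    rcases le_total 0 y with hy | hy
    · exact hpos x y hy hxy
    · rcases le_total 0 x with hx | hx
      · simpa using hopp x (-y) (by linarith) hx
      · have h := hpos (-y) (-x) (by linarith) (by linarith)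
        rw [signedPow_neg, signedPow_neg, abs_neg, abs_neg] at h
        have e1 : -signedPow a y - -signedPow a x = signedPow a x - signedPow a y := by ring
        have e2 : -y - -x = x - y := by ring
        rwa [e1, e2, add_comm |y|] at h
  rcases le_total y x with h | h
  · exact hall x y h
  · have := hall y x h
    rwa [abs_sub_comm, add_comm |y|, abs_sub_comm y x] at this

/-- The Mazur map from `ℓ_p` to `ℓ_q`. -/
lemma exists_mazur_map {p q : ℝ} (hq : 2 ≤ q) (hqp : q < p)
    [Fact (1 ≤ ENNReal.ofReal p)] [Fact (1 ≤ ENNReal.ofReal q)] :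
    ∃ M : SeqLp p → SeqLp q, ∀ (u v : SeqLp p) (R : ℝ), 0 < R → ‖u‖ ≤ R → ‖v‖ ≤ R →
      ‖M u - M v‖ ≤ p / q * (4 * R) ^ (p / q - 1) * ‖u - v‖ ∧
        (1 / 2) ^ (p / q) * ‖u - v‖ ^ (p / q) ≤ ‖M u - M v‖ := by
  have hq0 : 0 < q := by linarith
  have hp0 : 0 < p := by linarith
  set a := p / q - 1 with ha
  have ha0 : 0 < a := by
    have : 1 < p / q := (one_lt_div hq0).2 hqp
    linarith
  have ha1 : p / q = 1 + a := by rw [ha]; ring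
  have haq : (1 + a) * q = p := by rw [← ha1]; field_simp
  have hmem : ∀ u : SeqLp p, Memℓp (fun i => signedPow a (u i)) (ENNReal.ofReal q) := by
    intro u
    refine memℓp_gen ?_
    rw [ENNReal.toReal_ofReal hq0.le]
    refine (seqLp_summable hp0 u).congr fun i => ?_
    rw [Real.norm_eq_abs, abs_signedPow ha0, ← Real.rpow_mul (abs_nonneg _), haq]
  let M : SeqLp p → SeqLp q := fun u => ⟨fun i => signedPow a (u i), hmem u⟩
  refine ⟨M, fun u v R hR hu hv => ?_⟩
  have hMn : ‖M u - M v‖ ^ q = ∑' i, |signedPow a (u i) - signedPow a (v i)| ^ q :=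
    seqLp_norm_rpow hq0 (M u - M v)
  have hMs : Summable fun i => |signedPow a (u i) - signedPow a (v i)| ^ q :=
    seqLp_summable hq0 (M u - M v)
  have hdn : ‖u - v‖ ^ p = ∑' i, |u i - v i| ^ p := seqLp_norm_rpow hp0 (u - v)
  have hds : Summable fun i => |u i - v i| ^ p := seqLp_summable hp0 (u - v)
  rw [ha1]
  constructor
  · have hA : ∀ i, (|u i| + |v i|) ^ p ≤ 2 ^ p * (|u i| ^ p + |v i| ^ p) := by
      intro i
      have h1 : 0 ≤ |u i| ^ p := by positivity
      have h2 : 0 ≤ |v i| ^ p := by positivity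
      rcases le_total |u i| |v i| with h | h
      · have h3 : (|u i| + |v i|) ^ p ≤ (2 * |v i|) ^ p := by gcongr; linarith
        rw [Real.mul_rpow two_pos.le (abs_nonneg _)] at h3
        exact h3.trans (by gcongr; linarith)
      · have h3 : (|u i| + |v i|) ^ p ≤ (2 * |u i|) ^ p := by gcongr; linarith
        rw [Real.mul_rpow two_pos.le (abs_nonneg _)] at h3
        exact h3.trans (by gcongr; linarith)
    have hS := ((seqLp_summable hp0 u).add (seqLp_summable hp0 v)).mul_left (2 ^ p)
    have hAs : Summable fun i => (|u i| + |v i|) ^ p :=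
      Summable.of_nonneg_of_le (fun i => by positivity) hA hS
    have hAle : ∑' i, (|u i| + |v i|) ^ p ≤ (4 * R) ^ p := by
      refine (hAs.tsum_le_tsum hA hS).trans ?_
      rw [tsum_mul_left, (seqLp_summable hp0 u).tsum_add (seqLp_summable hp0 v),
        ← seqLp_norm_rpow hp0, ← seqLp_norm_rpow hp0]
      have h1 : ‖u‖ ^ p ≤ R ^ p := by gcongr
      have h2 : ‖v‖ ^ p ≤ R ^ p := by gcongr
      have h3 : (2 : ℝ) ≤ 2 ^ p := by
        conv_lhs => rw [← Real.rpow_one 2]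
        exact Real.rpow_le_rpow_of_exponent_le one_le_two (by linarith)
      rw [show 4 * R = 2 * (2 * R) by ring, Real.mul_rpow two_pos.le (by positivity),
        Real.mul_rpow two_pos.le hR.le]
      have h4 : 0 ≤ R ^ p := by positivity
      gcongr
      nlinarith
    have hconj : (p / (p - q)).HolderConjugate (p / q) := by
      have : p - q ≠ 0 := by linarith
      rw [Real.holderConjugate_iff]
      refine ⟨(one_lt_div (by linarith)).2 (by linarith), ?_⟩
      field_simp
      ring
    have hpw1 : ∀ y : ℝ, 0 ≤ y → (y ^ (p - q)) ^ (p / (p - q)) = y ^ p := fun y hy => by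
      have : p - q ≠ 0 := by linarith
      rw [← Real.rpow_mul hy]
      congr 1
      field_simp
    have hpw2 : ∀ y : ℝ, 0 ≤ y → (y ^ q) ^ (p / q) = y ^ p := fun y hy => by
      rw [← Real.rpow_mul hy]
      congr 1
      field_simp
    have hH := Real.inner_le_Lp_mul_Lq_tsum_of_nonneg hconj
      (f := fun i => (|u i| + |v i|) ^ (p - q)) (g := fun i => |u i - v i| ^ q)
      (fun i => by positivity) (fun i => by positivity)
      (by simpa only [hpw1 _ (add_nonneg (abs_nonneg _) (abs_nonneg _))] using hAs)
      (by simpa only [hpw2 _ (abs_nonneg _)] using hds)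
    have hHs := Real.summable_mul_of_Lp_Lq_of_nonneg hconj
      (f := fun i => (|u i| + |v i|) ^ (p - q)) (g := fun i => |u i - v i| ^ q)
      (fun i => by positivity) (fun i => by positivity)
      (by simpa only [hpw1 _ (add_nonneg (abs_nonneg _) (abs_nonneg _))] using hAs)
      (by simpa only [hpw2 _ (abs_nonneg _)] using hds)
    simp only [hpw1 _ (add_nonneg (abs_nonneg _) (abs_nonneg _)), hpw2 _ (abs_nonneg _)] at hH
    rw [← hdn, ← hpw2 _ (norm_nonneg _), one_div (p / q),
      Real.rpow_rpow_inv (by positivity) (by positivity)] at hH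
    have h1 : (∑' i, (|u i| + |v i|) ^ p) ^ (1 / (p / (p - q))) ≤ (4 * R) ^ (p - q) := by
      have : 0 < p - q := by linarith
      refine (Real.rpow_le_rpow (tsum_nonneg fun i => by positivity) hAle
        (by positivity)).trans (le_of_eq ?_)
      rw [← hpw1 _ (by positivity), one_div, Real.rpow_rpow_inv (by positivity) (by positivity)]
    have haq' : a * q = p - q := by linarith
    have h2 : ‖M u - M v‖ ^ q ≤ ((1 + a) * (4 * R) ^ a * ‖u - v‖) ^ q := by
      rw [hMn, Real.mul_rpow (by positivity) (norm_nonneg _), Real.mul_rpow (by positivity)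
        (by positivity), ← Real.rpow_mul (by positivity), haq', mul_assoc]
      calc _ ≤ ∑' i, (1 + a) ^ q * ((|u i| + |v i|) ^ (p - q) * |u i - v i| ^ q) := by
            refine hMs.tsum_le_tsum (fun i => ?_) (hHs.mul_left _)
            refine (Real.rpow_le_rpow (abs_nonneg _) (signedPow_bounds ha0 _ _).1
              hq0.le).trans (le_of_eq ?_)
            rw [Real.mul_rpow (by positivity) (by positivity), Real.mul_rpow (by positivity)
              (abs_nonneg _), ← Real.rpow_mul (by positivity), haq']
        _ = (1 + a) ^ q * ∑' i, ((|u i| + |v i|) ^ (p - q) * |u i - v i| ^ q) := tsum_mul_left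
        _ ≤ _ := by
            refine mul_le_mul_of_nonneg_left (hH.trans ?_) (by positivity)
            gcongr
    exact (Real.rpow_le_rpow_iff (norm_nonneg _) (by positivity) hq0).1 h2
  · have h2 : ((1 / 2) ^ (1 + a) * ‖u - v‖ ^ (1 + a)) ^ q ≤ ‖M u - M v‖ ^ q := by
      rw [hMn, Real.mul_rpow (by positivity) (by positivity),
        ← Real.rpow_mul (norm_nonneg _), haq, hdn, ← tsum_mul_left]
      refine (hds.mul_left _).tsum_le_tsum (fun i => ?_) hMs
      refine le_trans (le_of_eq ?_) (Real.rpow_le_rpow (by positivity)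
        (signedPow_bounds ha0 _ _).2 hq0.le)
      rw [Real.mul_rpow (by positivity) (by positivity), ← Real.rpow_mul (abs_nonneg _), haq]
    exact (Real.rpow_le_rpow_iff (by positivity) (norm_nonneg _) hq0).1 h2

/-- A uniform homeomorphism of power type transfers embeddings of finite sets to local maps. -/
lemma hasLocalMaps_of_map {E F : Type*} [NormedAddCommGroup E] [NormedSpace ℝ E]
    [NormedAddCommGroup F] {S K δ a θ B : ℝ} (hS : 1 ≤ S) (hK : 0 < K) (hδ : 0 < δ) (hB : 0 < B)
    (hE : ∀ u v : E, ‖u + v‖ ^ 2 + ‖u - v‖ ^ 2 ≤ 2 * ‖u‖ ^ 2 + 2 * S * ‖v‖ ^ 2) (M : E → F)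
    (hM : ∀ (u v : E) (R : ℝ), 0 < R → ‖u‖ ≤ R → ‖v‖ ≤ R →
      ‖M u - M v‖ ≤ K * R ^ a * ‖u - v‖ ∧ δ * ‖u - v‖ ^ (1 + a) ≤ ‖M u - M v‖)
    (hemb : ∀ (m : ℕ) (N : Set F), 1 ≤ m → N.Finite → N.ncard ≤ 2 ^ m →
      EmbedsWithDistortion N SeqL2 (B * (m : ℝ) ^ θ)) :
    HasLocalMaps E a θ (δ / (B * K * (6 * S))) := by
  classical
  have hS0 : 0 < S := by linarith
  intro m z R N hm hR hN hNm hNR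
  have hm0 : (0 : ℝ) < m := by exact_mod_cast hm
  obtain ⟨s, hs, f, hf⟩ := hemb m ((fun u => M (u - z)) '' N) hm (hN.image _)
    ((Set.ncard_image_le hN).trans hNm)
  set L := K * R ^ a with hL
  have hL0 : 0 < L := by positivity
  let e : N → (fun u => M (u - z)) '' N := fun u => ⟨M (u - z), u, u.2, rfl⟩
  have he : ∀ u v : N, dist (e u) (e v) = ‖M (u - z) - M (v - z)‖ := fun u v => by
    rw [Subtype.dist_eq, dist_eq_norm]
  let g : E → SeqL2 := fun u => if hu : u ∈ N then (s * L)⁻¹ • f (e ⟨u, hu⟩) else 0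
  have hg : ∀ u v : N, ‖g u - g v‖ = dist (f (e u)) (f (e v)) / (s * L) := by
    intro u v
    have hu : g u = (s * L)⁻¹ • f (e u) := dif_pos u.2
    have hv : g v = (s * L)⁻¹ • f (e v) := dif_pos v.2
    rw [hu, hv, ← smul_sub, norm_smul, Real.norm_of_nonneg (by positivity), dist_eq_norm,
      div_eq_inv_mul]
  have hball : ∀ u ∈ N, ‖u - z‖ ≤ R := fun u hu => by
    rw [← dist_eq_norm]; exact hNR hu
  have hMuv : ∀ u v : N, dist (e u) (e v) ≤ L * ‖(u : E) - v‖ ∧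
      δ * ‖(u : E) - v‖ ^ (1 + a) ≤ dist (e u) (e v) := fun u v => by
    have := hM (u - z) (v - z) R hR (hball u u.2) (hball v v.2)
    rwa [sub_sub_sub_cancel_right, ← he] at this
  have hgl : ∀ u ∈ N, ∀ v ∈ N, ‖g u - g v‖ ≤ ‖u - v‖ := fun u hu v hv => by
    rw [hg ⟨u, hu⟩ ⟨v, hv⟩, div_le_iff₀ (by positivity)]
    refine (hf _ _).2.trans ?_
    have := mul_le_mul_of_nonneg_left (hMuv ⟨u, hu⟩ ⟨v, hv⟩).1 hs.le
    refine this.trans (le_of_eq ?_)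
    ring
  obtain ⟨F, hFN, hFl⟩ := exists_lipschitz_extension hS hE N g hgl
  have hF : ∀ x y, ‖(6 * S)⁻¹ • F x - (6 * S)⁻¹ • F y‖ = ‖F x - F y‖ / (6 * S) := fun x y => by
    rw [← smul_sub, norm_smul, Real.norm_of_nonneg (by positivity), div_eq_inv_mul]
  refine ⟨fun x => (6 * S)⁻¹ • F x, fun x y => ?_, fun u hu v hv => ?_⟩
  · rw [hF, div_le_iff₀ (by positivity)]
    linarith [hFl x y]
  · rw [hF, hFN u hu, hFN v hv, hg ⟨u, hu⟩ ⟨v, hv⟩]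
    have h1 := (hf (e ⟨u, hu⟩) (e ⟨v, hv⟩)).1
    have h2 := (hMuv ⟨u, hu⟩ ⟨v, hv⟩).2
    have h3 : s / (B * (m : ℝ) ^ θ) * (δ * ‖u - v‖ ^ (1 + a)) ≤
        dist (f (e ⟨u, hu⟩)) (f (e ⟨v, hv⟩)) :=
      le_trans (mul_le_mul_of_nonneg_left h2 (by positivity)) h1
    refine le_trans (le_of_eq ?_) (div_le_div_of_nonneg_right
      (div_le_div_of_nonneg_right h3 (by positivity : 0 ≤ s * L)) (by positivity))
    rw [hL]
    have hx : 0 < (m : ℝ) ^ θ := by positivity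
    have hy : 0 < R ^ a := by positivity
    generalize ‖u - v‖ ^ (1 + a) = t
    generalize (m : ℝ) ^ θ = x at hx ⊢
    generalize R ^ a = y at hy ⊢
    field_simp

/-- Embeddings of finite subsets of `ℓ_q` give local maps on `ℓ_p`. -/
lemma exists_hasLocalMaps {p q θ B : ℝ} (hq : 2 ≤ q) (hqp : q < p)
    [Fact (1 ≤ ENNReal.ofReal p)] [Fact (1 ≤ ENNReal.ofReal q)] (hB : 0 < B)
    (hemb : ∀ (m : ℕ) (N : Set (SeqLp q)), 1 ≤ m → N.Finite → N.ncard ≤ 2 ^ m →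
      EmbedsWithDistortion N SeqL2 (B * (m : ℝ) ^ θ)) :
    ∃ c : ℝ, 0 < c ∧ HasLocalMaps (SeqLp p) (p / q - 1) θ c := by
  have hq0 : 0 < q := by linarith
  have hp0 : 0 < p := by linarith
  obtain ⟨M, hM⟩ := exists_mazur_map hq hqp
  have hS : 1 ≤ 4 + 2 * p * 2 ^ p := by
    have : 0 ≤ 2 * p * 2 ^ p := by positivity
    linarith
  have hK : 0 < p / q * 4 ^ (p / q - 1) := by positivity
  have hδ : (0 : ℝ) < (1 / 2) ^ (p / q) := by positivity
  refine ⟨_, ?_, hasLocalMaps_of_map hS hK hδ hB (seqLp_smooth (by linarith)) M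
    (fun u v R hR hu hv => ?_) hemb⟩
  · have : 0 < 4 + 2 * p * 2 ^ p := by linarith
    exact div_pos hδ (by positivity)
  · have h := hM u v R hR hu hv
    rw [Real.mul_rpow (by norm_num) hR.le, ← mul_assoc] at h
    rwa [add_sub_cancel]

lemma EmbedsWithDistortion.mono {M N : Type*} [PseudoMetricSpace M] [PseudoMetricSpace N]
    {D D' : ℝ} (h : EmbedsWithDistortion M N D) (hD : 0 < D) (hDD' : D ≤ D') :
    EmbedsWithDistortion M N D' := by
  obtain ⟨s, hs, f, hf⟩ := h
  refine ⟨s, hs, f, fun x y => ⟨le_trans ?_ (hf x y).1, (hf x y).2⟩⟩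
  gcongr

/-- The Fréchet embedding of a finite metric space. -/
lemma embedsWithDistortion_card (X : Type*) [Fintype X] [PseudoMetricSpace X] :
    EmbedsWithDistortion X SeqL2 (Fintype.card X + 1) := by
  let f : X → EuclideanSpace ℝ X := fun x => WithLp.toLp 2 fun c => dist x c
  obtain ⟨g, hg⟩ := exists_seqL2_inner_eq f
  have hfg : ∀ x y, dist (g x) (g y) = ‖f x - f y‖ := fun x y => by
    rw [dist_eq_norm]
    exact norm_sub_eq_of_inner_eq hg x y
  have hn : (0 : ℝ) < Fintype.card X + 1 := by positivity
  refine ⟨Fintype.card X + 1, hn, g, fun x y => ?_⟩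
  rw [hfg, div_self hn.ne', one_mul]
  constructor
  · have h := PiLp.norm_apply_le (f x - f y) y
    have e : (f x - f y) y = dist x y := by simp [f]
    rwa [e, Real.norm_of_nonneg dist_nonneg] at h
  · refine abs_le_of_sq_le_sq' ?_ (by positivity) |>.2
    rw [EuclideanSpace.norm_sq_eq]
    have h1 : ∀ c, ‖(f x - f y) c‖ ^ 2 ≤ dist x y ^ 2 := fun c => by
      refine pow_le_pow_left₀ (norm_nonneg _) ?_ 2
      exact abs_dist_sub_le x y c
    refine (Finset.sum_le_sum fun c _ => h1 c).trans ?_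
    rw [Finset.sum_const, Finset.card_univ, nsmul_eq_mul, mul_pow]
    gcongr
    have : (0 : ℝ) ≤ Fintype.card X := by positivity
    nlinarith

lemma c2_le {X : Type*} [PseudoMetricSpace X] {D : ℝ} (hD : 1 ≤ D)
    (h : EmbedsWithDistortion X SeqL2 D) : c2 X ≤ D :=
  csInf_le ⟨1, fun _ h => h.1⟩ ⟨hD, h⟩

lemma exists_embedding_lt {X : Type*} [Finite X] [PseudoMetricSpace X] {K : ℝ} (h : c2 X < K) :
    EmbedsWithDistortion X SeqL2 K := by
  have := Fintype.ofFinite X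
  obtain ⟨D, ⟨hD, hDX⟩, hDK⟩ := exists_lt_of_csInf_lt
    (s := {D : ℝ | 1 ≤ D ∧ EmbedsWithDistortion X (lp (fun _ : ℕ => ℝ) 2) D})
    ⟨_, by simp, embedsWithDistortion_card X⟩ h
  exact hDX.mono (by linarith) hDK.le

lemma bddAbove_c2 (M : Type*) [PseudoMetricSpace M] (n : ℕ) :
    BddAbove {r : ℝ | ∃ C : Set M, C.Finite ∧ C.ncard ≤ n ∧ r = c2 ↥C} := by
  refine ⟨n + 1, ?_⟩
  rintro r ⟨C, hC, hCn, rfl⟩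
  have := hC.fintype
  have h := embedsWithDistortion_card C
  have hcard : (Fintype.card C : ℝ) ≤ n := by
    rw [← Nat.card_eq_fintype_card]
    exact_mod_cast hCn
  exact (c2_le (by simp) h).trans (by linarith)

lemma embedsWithDistortion_of_c2n_lt {M : Type*} [PseudoMetricSpace M] {n : ℕ} {K : ℝ}
    (h : c2n M n < K) {C : Set M} (hC : C.Finite) (hCn : C.ncard ≤ n) :
    EmbedsWithDistortion C SeqL2 K := by
  have := hC.to_subtype
  exact exists_embedding_lt ((le_csSup (bddAbove_c2 M n) ⟨C, hC, hCn, rfl⟩).trans_lt h)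

lemma exists_c2n_le_of_embeddings {M : Type*} [PseudoMetricSpace M] {C θ : ℝ} (hC : 0 < C)
    (hθ : 0 ≤ θ) (h : ∀ n : ℕ, 2 ≤ n → ∀ X : Set M, X.Finite → X.ncard ≤ n →
      EmbedsWithDistortion X SeqL2 (C * Real.log n ^ θ)) :
    ∃ ν : ℝ, 0 < ν ∧ ∀ n : ℕ, 2 ≤ n → c2n M n ≤ ν * Real.log n ^ θ := by
  have hl2 : 0 < Real.log 2 := Real.log_pos one_lt_two
  refine ⟨max C (Real.log 2 ^ θ)⁻¹, lt_max_of_lt_left hC, fun n hn => ?_⟩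
  have hn' : (2 : ℝ) ≤ n := by exact_mod_cast hn
  have hl : Real.log 2 ≤ Real.log n := Real.log_le_log two_pos hn'
  have hln : 0 < Real.log n := hl2.trans_le hl
  have h1 : Real.log 2 ^ θ ≤ Real.log n ^ θ := Real.rpow_le_rpow hl2.le hl hθ
  have h2 : 1 ≤ max C (Real.log 2 ^ θ)⁻¹ * Real.log n ^ θ := by
    calc 1 = (Real.log 2 ^ θ)⁻¹ * Real.log 2 ^ θ := (inv_mul_cancel₀ (by positivity)).symm
      _ ≤ _ := mul_le_mul (le_max_right _ _) h1 (by positivity) (hC.le.trans (le_max_left _ _))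
  refine csSup_le ⟨_, ∅, Set.finite_empty, by simp, rfl⟩ ?_
  rintro r ⟨X, hX, hXn, rfl⟩
  exact c2_le h2 ((h n hn X hX hXn).mono (by positivity) (by gcongr; exact le_max_left _ _))

lemma embeddings_of_c2n_le {M : Type*} [PseudoMetricSpace M] {ν θ θ' : ℝ} (hν : 0 < ν)
    (hθ : 0 ≤ θ) (hθ' : θ ≤ θ') (h : ∀ n : ℕ, 2 ≤ n → c2n M n ≤ ν * Real.log n ^ θ)
    (m : ℕ) (N : Set M) (hm : 1 ≤ m) (hN : N.Finite) (hNm : N.ncard ≤ 2 ^ m) :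
    EmbedsWithDistortion N SeqL2 (2 * ν * (m : ℝ) ^ θ') := by
  have hm' : (1 : ℝ) ≤ m := by exact_mod_cast hm
  have hl2 : 0 < Real.log 2 := Real.log_pos one_lt_two
  refine embedsWithDistortion_of_c2n_lt ((h (2 ^ m) ?_).trans_lt ?_) hN hNm
  · calc 2 = 2 ^ 1 := rfl
      _ ≤ 2 ^ m := Nat.pow_le_pow_right two_pos hm
  · push_cast
    rw [Real.log_pow]
    have h1 : (m * Real.log 2) ^ θ ≤ (m : ℝ) ^ θ := by
      refine Real.rpow_le_rpow (by positivity) ?_ hθ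
      have := Real.log_two_lt_d9
      nlinarith
    have h2 : (m : ℝ) ^ θ ≤ (m : ℝ) ^ θ' := Real.rpow_le_rpow_of_exponent_le hm' hθ'
    have h3 := mul_le_mul_of_nonneg_left (h1.trans h2) hν.le
    have h4 : 0 < ν * (m : ℝ) ^ θ' := by positivity
    linarith

lemma embedsWithDistortion_lp_two {r : ℝ≥0∞} [Fact (1 ≤ r)] (hr : r = 2)
    (N : Set (lp (fun _ : ℕ => ℝ) r)) : EmbedsWithDistortion N SeqL2 1 := by
  subst hr
  exact ⟨1, one_pos, Subtype.val, fun x y => by simp [Subtype.dist_eq]⟩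

/-- A bound for subsets of `ℓ_q` yields one for subsets of `ℓ_p`. -/
lemma exists_c2n_le_of_lt {p q θ B ε : ℝ} (hq : 2 ≤ q) (hqp : q < p)
    [Fact (1 ≤ ENNReal.ofReal p)] [Fact (1 ≤ ENNReal.ofReal q)] (hB : 0 < B) (hθ : 1 / 2 ≤ θ)
    (hε : 0 < ε)
    (hemb : ∀ (m : ℕ) (N : Set (SeqLp q)), 1 ≤ m → N.Finite → N.ncard ≤ 2 ^ m →
      EmbedsWithDistortion N SeqL2 (B * (m : ℝ) ^ θ)) :
    0 ≤ θ + (p / q - 1) + ε ∧ ∃ ν : ℝ, 0 < ν ∧ ∀ n : ℕ, 2 ≤ n →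
      c2n (SeqLp p) n ≤ ν * Real.log n ^ (θ + (p / q - 1) + ε) := by
  have ha : 0 ≤ p / q - 1 := by
    have : 1 < p / q := (one_lt_div (by linarith)).2 hqp
    linarith
  obtain ⟨c, hc, hloc⟩ := exists_hasLocalMaps hq hqp hB hemb
  obtain ⟨C, hC, hX⟩ := exists_embedding_of_hasLocalMaps hloc ha hc hθ hε
  exact ⟨by linarith, exists_c2n_le_of_embeddings hC (by linarith) hX⟩

lemma exists_exponent {q : ℝ} (hq : 2 ≤ q) [Fact (1 ≤ ENNReal.ofReal q)] :
    ∃ θ : ℝ, 0 ≤ θ ∧ ∃ ν : ℝ, 0 < ν ∧ ∀ n : ℕ, 2 ≤ n →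
      c2n (SeqLp q) n ≤ ν * Real.log n ^ θ := by
  have h2 : ENNReal.ofReal 2 = 2 := by simp
  rcases hq.eq_or_lt with rfl | hq
  · refine ⟨0, le_rfl, exists_c2n_le_of_embeddings one_pos le_rfl fun n _ X _ _ => ?_⟩
    rw [Real.rpow_zero, mul_one]
    exact embedsWithDistortion_lp_two h2 X
  · have : Fact (1 ≤ ENNReal.ofReal 2) := ⟨by rw [h2]; exact one_le_two⟩
    refine ⟨_, exists_c2n_le_of_lt le_rfl hq one_pos le_rfl one_pos fun m N hm _ _ => ?_⟩
    rw [one_mul]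
    exact (embedsWithDistortion_lp_two h2 N).mono one_pos
      (Real.one_le_rpow (by exact_mod_cast hm) (by norm_num))

/-- For all reals `2 ≤ q < p < ∞`, the Euclidean-embedding exponents satisfy
`ξ_p ≤ max (1/2) (ξ_q) + p/q − 1`. -/
theorem xi_recursive_bound (p q : ℝ) (hq : 2 ≤ q) (hqp : q < p)
    [Fact (1 ≤ ENNReal.ofReal p)] [Fact (1 ≤ ENNReal.ofReal q)] :
    xi p ≤ max (1 / 2) (xi q) + p / q - 1 := by
  refine le_of_forall_pos_le_add fun ε hε => ?_
  obtain ⟨θ, ⟨hθ, ν, hν, hc⟩, hθε⟩ := exists_lt_of_csInf_lt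
    (s := {θ : ℝ | 0 ≤ θ ∧ ∃ ν : ℝ, 0 < ν ∧ ∀ n : ℕ, 2 ≤ n →
      c2n (lp (fun _ : ℕ => ℝ) (ENNReal.ofReal q)) n ≤ ν * Real.log n ^ θ})
    (exists_exponent hq) (show xi q < xi q + ε / 2 by linarith)
  have h1 : θ ≤ max (1 / 2) (xi q) + ε / 2 := by
    have := le_max_right (1 / 2) (xi q)
    linarith
  have h2 : 1 / 2 ≤ max (1 / 2) (xi q) + ε / 2 := by
    have := le_max_left (1 / 2) (xi q)
    linarith
  have h3 := exists_c2n_le_of_lt hq hqp (by positivity : 0 < 2 * ν) h2 (half_pos hε)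
    (embeddings_of_c2n_le hν hθ h1 hc)
  have h4 : xi p ≤ max (1 / 2) (xi q) + ε / 2 + (p / q - 1) + ε / 2 :=
    csInf_le ⟨0, fun _ h => h.1⟩ h3
  linarith
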